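/- arXiv:2105.09383 — 13 statements merged into one kernel-verified Lean document; each statement's English description precedes it below -/
import Mathlib

section
/- For every fair-division instance with n agents and additive nonnegative valuations, and for every subset N' of the agents with |N'| = ⌊2n/3⌋, there exists an allocation (A_1, …, A_n) of all the goods such that v_i(A_i) ≥ MMS_i^n(M) for every agent i ∈ N'. -/
open Finset

noncomputable def mms {G : Type*} [Fintype G] [DecidableEq G]
    (M : Finset G) (w : G → ℝ) (k : ℕ) (hk : 0 < k) : ℝ :=
  Finset.univ.sup' ⟨fun _ => ⟨0, hk⟩, Finset.mem_univ _⟩ fun P : G → Fin k =>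
    Finset.univ.inf' ⟨⟨0, hk⟩, Finset.mem_univ _⟩ fun j : Fin k =>
      ∑ g ∈ M.filter (fun g => P g = j), w g

noncomputable def bval {G : Type*} [Fintype G] {n : ℕ}
    (w : G → ℝ) (A : G → Fin n) (i : Fin n) : ℝ :=
  ∑ g ∈ Finset.univ.filter (fun g => A g = i), w g

/-- Value of the bag with index `j` and filler set `S`. -/
noncomputable def bagVal (u : ℕ → ℝ) (k j : ℕ) (S : Finset ℕ) : ℝ :=
  u j + u (2 * k - 1 - j) + ∑ p ∈ S, u p

lemma sum_split (k L : ℕ) (hL : 2 * k ≤ L) (S : ℕ → Finset ℕ)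
    (hS : ∀ j < k, S j ⊆ Ico (2 * k) L)
    (hdisj : ∀ i < k, ∀ j < k, i ≠ j → Disjoint (S i) (S j))
    (hcov : ∀ p ∈ Ico (2 * k) L, ∃ j < k, p ∈ S j) (w : ℕ → ℝ) :
    ∑ p ∈ range L, w p = ∑ j ∈ range k, bagVal w k j (S j) := by
  have h1 : ∑ p ∈ range L, w p = ∑ p ∈ range (2 * k), w p + ∑ p ∈ Ico (2 * k) L, w p :=
    (Finset.sum_range_add_sum_Ico w hL).symm
  have h2 : Ico (2 * k) L = (range k).biUnion S := by
    ext p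
    simp only [mem_biUnion, mem_range]
    constructor
    · intro hp
      obtain ⟨j, hj, hp⟩ := hcov p hp
      exact ⟨j, hj, hp⟩
    · rintro ⟨j, hj, hp⟩
      exact hS j hj hp
  have h3 : ∑ p ∈ range (2 * k), w p = ∑ j ∈ range k, (w j + w (2 * k - 1 - j)) := by
    rw [two_mul, Finset.sum_range_add, sum_add_distrib]
    congr 1
    rw [← Finset.sum_range_reflect]
    apply sum_congr rfl
    intro j hj
    rw [mem_range] at hj
    congr 1
    omega
  rw [h1, h2, h3, sum_biUnion, ← sum_add_distrib]
  · rfl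
  · intro i hi j hj hij
    exact hdisj i (by simpa using hi) j (by simpa using hj) hij

lemma min_sum_le (T : Finset ℕ) (u : ℕ → ℝ) (h0 : ∀ p, 0 ≤ u p) (τ : ℝ) (hτ : 0 ≤ τ) :
    min (∑ p ∈ T, u p) τ ≤ ∑ p ∈ T, min (u p) τ := by
  by_cases h : ∃ p ∈ T, τ < u p
  · obtain ⟨p, hp, hlt⟩ := h
    calc min (∑ p ∈ T, u p) τ ≤ τ := min_le_right _ _
      _ = min (u p) τ := by rw [min_eq_right hlt.le]
      _ ≤ _ := Finset.single_le_sum (f := fun p => min (u p) τ)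
          (fun q _ => le_min (h0 q) hτ) hp
  · push Not at h
    rw [sum_congr rfl (fun p hp => min_eq_left (h p hp))]
    exact min_le_left _ _

lemma two_min_sum_le (T : Finset ℕ) (u : ℕ → ℝ) (h0 : ∀ p, 0 ≤ u p) (τ : ℝ) (hτ : 0 ≤ τ)
    (hτ2 : τ ≤ 1 / 2) (hu : ∀ p ∈ T, u p ≤ 1 / 2) (hs : ∑ p ∈ T, u p = 1) :
    2 * τ ≤ ∑ p ∈ T, min (u p) τ := by
  by_cases h : ∃ p ∈ T, τ < u p
  · obtain ⟨p, hp, hlt⟩ := h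
    have h1 := min_sum_le (T.erase p) u h0 τ hτ
    have h2 := Finset.add_sum_erase T u hp
    have h3 := Finset.add_sum_erase T (fun p => min (u p) τ) hp
    have h4 := hu p hp
    rw [min_eq_right (by linarith)] at h1
    simp only [min_eq_right hlt.le] at h3
    linarith
  · push Not at h
    rw [sum_congr rfl (fun p hp => min_eq_left (h p hp))]
    linarith

lemma bundle_bound (T : Finset ℕ) (u : ℕ → ℝ) (h0 : ∀ p, 0 ≤ u p) (τ : ℝ) (hτ : 0 ≤ τ)
    (hτ2 : τ ≤ 1 / 2) (h : ℕ) (hh : ∀ p ∈ T, p < h ↔ 1 / 2 < u p)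
    (hs : ∑ p ∈ T, u p = 1) :
    2 * τ + ∑ p ∈ T, (if p < h then min (1 - u p) τ - 2 * τ else 0)
      ≤ ∑ p ∈ T, (if p < h then 0 else min (u p) τ) := by
  by_cases hb : ∃ b ∈ T, b < h
  · obtain ⟨b, hbT, hbh⟩ := hb
    have hbu := (hh b hbT).1 hbh
    have h2 := Finset.add_sum_erase T u hbT
    have hno : ∀ p ∈ T.erase b, ¬ p < h := by
      intro p hp hph
      have h3 := (hh p (mem_of_mem_erase hp)).1 hph
      have h4 := Finset.single_le_sum (f := u) (fun q _ => h0 q) hp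
      linarith
    rw [← Finset.add_sum_erase T _ hbT, ← Finset.add_sum_erase T _ hbT,
      sum_congr rfl (fun p hp => if_neg (hno p hp)),
      sum_congr rfl (fun p hp => if_neg (hno p hp)), if_pos hbh, if_pos hbh]
    have h1 := min_sum_le (T.erase b) u h0 τ hτ
    have h5 : ∑ p ∈ T.erase b, u p = 1 - u b := by linarith
    rw [h5] at h1
    simp only [sum_const_zero]
    linarith
  · push Not at hb
    have hno : ∀ p ∈ T, ¬ p < h := fun p hp => not_lt.2 (hb p hp)
    rw [sum_congr rfl (fun p hp => if_neg (hno p hp)),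
      sum_congr rfl (fun p hp => if_neg (hno p hp))]
    have := two_min_sum_le T u h0 τ hτ hτ2
      (fun p hp => not_lt.1 (fun hlt => hno p hp ((hh p hp).2 hlt))) hs
    simpa using this

lemma acct (k d L : ℕ) (hkd : 3 * k ≤ 2 * d) (hL : 2 * k ≤ L) (u : ℕ → ℝ)
    (ha : Antitone u) (h0 : ∀ p, 0 ≤ u p) (c : ℕ → Fin d)
    (hc : ∀ l, ∑ p ∈ range L with c p = l, u p = 1)
    (S : ℕ → Finset ℕ)
    (hS : ∀ j < k, S j ⊆ Ico (2 * k) L)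
    (hdisj : ∀ i < k, ∀ j < k, i ≠ j → Disjoint (S i) (S j))
    (hcov : ∀ p ∈ Ico (2 * k) L, ∃ j < k, p ∈ S j)
    (hB : ∀ j < k, S j = ∅ ∨ (∃ s ∈ S j, bagVal u k j ((S j).erase s) < 1)
      ∨ bagVal u k j (S j) < 1)
    (j0 : ℕ) (hj0 : j0 < k) (hj : bagVal u k j0 (S j0) < 1) : False := by
  have hkd' : (3 : ℝ) * k ≤ 2 * d := by exact_mod_cast hkd
  have htot : ∑ p ∈ range L, u p = d := by
    rw [← Finset.sum_fiberwise (range L) c u]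
    simp [hc]
  have hle1 : ∀ p < L, u p ≤ 1 := by
    intro p hp
    rw [← hc (c p)]
    exact Finset.single_le_sum (f := u) (fun q _ => h0 q) (by simp [hp])
  have hsplit := sum_split k L hL S hS hdisj hcov
  by_cases hA : u k ≤ 1 / 2
  · -- no bag starts with two big goods
    have hsm : ∀ p, k ≤ p → u p ≤ 1 / 2 := fun p hp => (ha hp).trans hA
    have hbag : ∀ j ∈ range k, bagVal u k j (S j) ≤ 3 / 2 := by
      intro j hjk
      rw [mem_range] at hjk
      rcases hB j hjk with h | ⟨s, hs, h⟩ | h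
      · rw [bagVal, h, sum_empty]
        have := hle1 j (by omega)
        have := hsm (2 * k - 1 - j) (by omega)
        linarith
      · have h2 := Finset.add_sum_erase (S j) u hs
        have h3 := mem_Ico.1 (hS j hjk hs)
        have h4 := hsm s (by omega)
        unfold bagVal at *
        linarith
      · linarith
    have := Finset.sum_lt_sum hbag ⟨j0, mem_range.2 hj0, by linarith⟩
    rw [← hsplit, htot] at this
    simp at this
    linarith
  · push Not at hA
    -- the number of big goods
    have hex : ∃ h, u h ≤ 1 / 2 ∨ L ≤ h := ⟨L, Or.inr le_rfl⟩
    classical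
    obtain ⟨h, hhdef⟩ : ∃ h, h = Nat.find hex := ⟨_, rfl⟩
    have hspec := Nat.find_spec hex
    have hmin : ∀ p < h, 1 / 2 < u p ∧ p < L := by
      intro p hp
      have := Nat.find_min hex (hhdef ▸ hp)
      push Not at this
      exact this
    rw [← hhdef] at hspec
    have hhL : h ≤ L := by
      by_contra hcon
      exact absurd (hmin L (by omega)).2 (lt_irrefl _)
    have hh : ∀ p ∈ range L, p < h ↔ 1 / 2 < u p := by
      intro p hp
      rw [mem_range] at hp
      constructor
      · exact fun hp => (hmin p hp).1
      · intro hlt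
        by_contra hcon
        rcases hspec with h1 | h1
        · have := ha (not_lt.1 hcon)
          linarith
        · omega
    have hkh : k < h := (hh k (mem_range.2 (by omega))).2 hA
    have hj0S := hj
    have hjh : j0 + h < 2 * k := by
      by_contra hcon
      have h1 := (hmin j0 (by omega)).1
      have h2 := (hmin (2 * k - 1 - j0) (by omega)).1
      have h3 : 0 ≤ ∑ p ∈ S j0, u p := sum_nonneg (fun p _ => h0 p)
      unfold bagVal at hj
      linarith
    obtain ⟨t, ht⟩ : ∃ t, t + h = 2 * k := ⟨2 * k - h, by omega⟩
    obtain ⟨τ, hτ⟩ : ∃ τ, τ = 1 - u (t - 1) := ⟨_, rfl⟩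
    have hτ0 : 0 ≤ τ := by linarith [hle1 (t - 1) (by omega)]
    have hτ2 : τ ≤ 1 / 2 := by linarith [(hmin (t - 1) (by omega)).1]
    -- lower bound
    have hlow : ∀ l ∈ (univ : Finset (Fin d)), 2 * τ + ∑ p ∈ range L with c p = l,
        (if p < h then min (1 - u p) τ - 2 * τ else 0)
        ≤ ∑ p ∈ range L with c p = l, (if p < h then 0 else min (u p) τ) := fun l _ =>
      bundle_bound _ u h0 τ hτ0 hτ2 h (fun p hp => hh p (mem_of_mem_filter p hp)) (hc l)
    have hlow2 := sum_le_sum hlow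
    rw [sum_add_distrib, Finset.sum_fiberwise, Finset.sum_fiberwise, hsplit
      (fun p => if p < h then 0 else min (u p) τ)] at hlow2
    have hbig : ∑ p ∈ range L, (if p < h then min (1 - u p) τ - 2 * τ else 0)
        = ∑ p ∈ range t, (1 - u p) + (h - t : ℝ) * τ - h * (2 * τ) := by
      rw [← sum_filter]
      have : (range L).filter (fun p => p < h) = range h := by
        ext p; simp; omega
      rw [this, sum_sub_distrib, ← Finset.sum_range_add_sum_Ico _ (show t ≤ h by omega)]
      congr 1
      · congr 1
        · apply sum_congr rfl
          intro p hp
          rw [mem_range] at hp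
          apply min_eq_left
          have := ha (show p ≤ t - 1 by omega)
          linarith
        · rw [sum_congr rfl (g := fun _ => τ)]
          · simp [Nat.cast_sub (show t ≤ h by omega)]
          · intro p hp
            rw [mem_Ico] at hp
            apply min_eq_right
            have := ha (show t - 1 ≤ p by omega)
            linarith
      · simp
    -- upper bound
    have hbv : ∀ j < k, bagVal (fun p => if p < h then 0 else min (u p) τ) k j (S j)
        = (if 2 * k - 1 - j < h then 0 else min (u (2 * k - 1 - j)) τ)
          + ∑ p ∈ S j, min (u p) τ := by
      intro j hjk
      have hSn : ∀ p ∈ S j, ¬ p < h := by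
        intro p hp
        have := mem_Ico.1 (hS j hjk hp)
        omega
      unfold bagVal
      rw [sum_congr rfl (fun p hp => if_neg (hSn p hp))]
      beta_reduce
      rw [if_pos (show j < h by omega), zero_add]
    have hup : ∀ j ∈ range k, bagVal (fun p => if p < h then 0 else min (u p) τ) k j (S j)
        ≤ if j < t then (1 - u j) + τ else 0 := by
      intro j hjk
      rw [mem_range] at hjk
      have hjh : j < h := by omega
      rw [hbv j hjk]
      split_ifs with hjt h2 h2
      · omega
      · have h3 := (hmin j hjh).1
        have h4 := (hmin _ hjt).1
        rcases hB j hjk with h | ⟨s, hs, h⟩ | h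
        · rw [h, sum_empty]
          linarith
        · have h5 : 0 ≤ ∑ p ∈ (S j).erase s, u p := sum_nonneg (fun p _ => h0 p)
          unfold bagVal at h
          linarith
        · have h5 : 0 ≤ ∑ p ∈ S j, u p := sum_nonneg (fun p _ => h0 p)
          unfold bagVal at h
          linarith
      · have hm := min_le_right (u (2 * k - 1 - j)) τ
        have hm' := min_le_left (u (2 * k - 1 - j)) τ
        have hj1 := hle1 j (by omega)
        have hms : ∀ T : Finset ℕ, ∑ p ∈ T, min (u p) τ ≤ ∑ p ∈ T, u p := fun T =>
          sum_le_sum (fun p _ => min_le_left _ _)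
        rcases hB j hjk with h | ⟨s, hs, h⟩ | h
        · rw [h, sum_empty]
          linarith
        · have h3 := Finset.add_sum_erase (S j) (fun p => min (u p) τ) hs
          have h4 := hms ((S j).erase s)
          have h5 := min_le_right (u s) τ
          unfold bagVal at h
          linarith
        · have h4 := hms (S j)
          unfold bagVal at h
          linarith
      · omega
    have hstrict : bagVal (fun p => if p < h then 0 else min (u p) τ) k j0 (S j0)
        < if j0 < t then (1 - u j0) + τ else 0 := by
      rw [hbv j0 hj0, if_pos (show j0 < t by omega), if_neg (by omega)]
      have hm' := min_le_left (u (2 * k - 1 - j0)) τ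
      have hms : ∑ p ∈ S j0, min (u p) τ ≤ ∑ p ∈ S j0, u p :=
        sum_le_sum (fun p _ => min_le_left _ _)
      unfold bagVal at hj
      linarith
    have hup2 := sum_lt_sum hup ⟨j0, mem_range.2 hj0, hstrict⟩
    have hsum : ∑ j ∈ range k, (if j < t then (1 - u j) + τ else 0)
        = ∑ j ∈ range t, (1 - u j) + t * τ := by
      rw [← sum_filter]
      have : (range k).filter (fun p => p < t) = range t := by
        ext p; simp; omega
      rw [this, sum_add_distrib]
      simp
    rw [hsum] at hup2
    rw [hbig] at hlow2
    simp only [sum_const, card_univ, Fintype.card_fin, nsmul_eq_mul] at hlow2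
    have ht' : (t : ℝ) + h = 2 * k := by exact_mod_cast ht
    have hkh' : (k : ℝ) < h := by exact_mod_cast hkh
    have hfin : 0 ≤ (2 * d - h - 2 * t : ℝ) * τ := mul_nonneg (by linarith) hτ0
    nlinarith

lemma fill_step (k L : ℕ) (hL : 2 * k ≤ L) {ι : Type*} [Fintype ι] [DecidableEq ι] [Nonempty ι]
    (hcard : Fintype.card ι = k) (d : ℕ) (hkd : 3 * k ≤ 2 * d)
    (u : ι → ℕ → ℝ)
    (ha : ∀ i, Antitone (u i)) (h0 : ∀ i p, 0 ≤ u i p) (c : ι → ℕ → Fin d)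
    (hc : ∀ i l, ∑ p ∈ range L with c i p = l, u i p = 1) (q : ℕ) (hq : q ≤ k) :
    ∃ (a : ℕ → ι) (S : ℕ → Finset ℕ), (∀ j, S j ⊆ Ico (2 * k) L) ∧
      (∀ i j, i ≠ j → Disjoint (S i) (S j)) ∧ (∀ j, q ≤ j → S j = ∅) ∧
      (∀ i < q, ∀ j < q, a i = a j → i = j) ∧
      (∀ j < q, 1 ≤ bagVal (u (a j)) k j (S j)) ∧
      (∀ i, (∀ j < q, a j ≠ i) → ∀ j < q, S j = ∅ ∨
        ∃ s ∈ S j, bagVal (u i) k j ((S j).erase s) < 1) := by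
  induction q with
  | zero =>
    refine ⟨fun _ => Classical.arbitrary ι, fun _ => ∅, ?_, ?_, ?_, ?_, ?_, ?_⟩ <;> simp
  | succ q ih =>
    obtain ⟨a, S, hS, hdisj, hemp, hinj, hval, hrem⟩ := ih (by omega)
    -- the remaining filler goods
    obtain ⟨F, hF⟩ : ∃ F, F = Ico (2 * k) L \ (range q).biUnion S := ⟨_, rfl⟩
    have hFS : ∀ j, j ≠ q → Disjoint (S j) F := by
      intro j hj
      by_cases hjq : j < q
      · rw [hF, disjoint_left]
        intro p hp hp2
        rw [mem_sdiff, mem_biUnion] at hp2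
        exact hp2.2 ⟨j, mem_range.2 hjq, hp⟩
      · rw [hemp j (by omega)]
        exact disjoint_empty_left _
    have hR : ∃ r, ∀ j < q, a j ≠ r := by
      by_contra hcon
      push Not at hcon
      have h1 : (univ : Finset ι) ⊆ (range q).image a := by
        intro r _
        obtain ⟨j, hj, hr⟩ := hcon r
        exact mem_image.2 ⟨j, mem_range.2 hj, hr⟩
      have h2 := (card_le_card h1).trans card_image_le
      rw [card_univ, card_range] at h2
      omega
    have hgood : ∃ F' ⊆ F, ∃ r, (∀ j < q, a j ≠ r) ∧ 1 ≤ bagVal (u r) k q F' := by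
      refine ⟨F, Subset.rfl, ?_⟩
      by_contra hcon
      push Not at hcon
      obtain ⟨r, hr⟩ := hR
      have hlt := hcon r hr
      refine acct k d L hkd hL (u r) (ha r) (h0 r) (c r) (hc r) (Function.update S q F)
        ?_ ?_ ?_ ?_ q (by omega) (by simpa using hlt)
      · intro j _
        by_cases hj : j = q
        · subst hj
          simp [hF]
        · simpa [hj] using hS j
      · intro i _ j _ hij
        by_cases hi : i = q
        · subst hi
          simpa [hij.symm] using (hFS j hij.symm).symm
        · by_cases hj : j = q
          · subst hj
            simpa [hij] using hFS i hij
          · simpa [hi, hj] using hdisj i j hij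
      · intro p hp
        by_cases hpF : p ∈ F
        · exact ⟨q, by omega, by simpa using hpF⟩
        · rw [hF, mem_sdiff, not_and, not_not, mem_biUnion] at hpF
          obtain ⟨j, hj, hpj⟩ := hpF hp
          rw [mem_range] at hj
          exact ⟨j, by omega, by simpa [hj.ne] using hpj⟩
      · intro j _
        rcases lt_trichotomy j q with hj | hj | hj
        · simp only [Function.update_of_ne hj.ne]
          rcases hrem r hr j hj with h | h
          · exact Or.inl h
          · exact Or.inr (Or.inl h)
        · subst hj
          simp only [Function.update_self]
          exact Or.inr (Or.inr hlt)
        · simp only [Function.update_of_ne hj.ne']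
          exact Or.inl (hemp j hj.le)
    classical
    -- a minimal filler set
    have hne : (F.powerset.filter (fun F' => ∃ r, (∀ j < q, a j ≠ r) ∧
        1 ≤ bagVal (u r) k q F')).Nonempty := by
      obtain ⟨F', h1, h2⟩ := hgood
      exact ⟨F', mem_filter.2 ⟨mem_powerset.2 h1, h2⟩⟩
    obtain ⟨F', hF', hmin⟩ := Finset.exists_min_image _ Finset.card hne
    rw [mem_filter, mem_powerset] at hF'
    obtain ⟨hF'F, r, hr, hrv⟩ := hF'
    have hFS' : ∀ j, j ≠ q → Disjoint (S j) F' := fun j hj =>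
      disjoint_of_subset_right hF'F (hFS j hj)
    have hminr : ∀ i, (∀ j < q, a j ≠ i) → ∀ s ∈ F', bagVal (u i) k q (F'.erase s) < 1 := by
      intro i hi s hs
      by_contra hcon
      have := hmin (F'.erase s) (mem_filter.2 ⟨mem_powerset.2
        ((erase_subset _ _).trans hF'F), i, hi, not_lt.1 hcon⟩)
      have h2 := card_erase_lt_of_mem hs
      omega
    refine ⟨Function.update a q r, Function.update S q F', ?_, ?_, ?_, ?_, ?_, ?_⟩
    · intro j
      by_cases hj : j = q
      · subst hj
        have : F' ⊆ Ico (2 * k) L := hF'F.trans (by rw [hF]; exact sdiff_subset)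
        simpa using this
      · simpa [hj] using hS j
    · intro i j hij
      by_cases hi : i = q
      · subst hi
        simpa [hij.symm] using (hFS' j hij.symm).symm
      · by_cases hj : j = q
        · subst hj
          simpa [hij] using hFS' i hij
        · simpa [hi, hj] using hdisj i j hij
    · intro j hj
      rw [Function.update_of_ne (by omega)]
      exact hemp j (by omega)
    · intro i hi j hj hij
      by_cases hiq : i = q
      · by_cases hjq : j = q
        · omega
        · subst hiq
          rw [Function.update_self, Function.update_of_ne hjq] at hij
          exact absurd hij.symm (hr j (by omega))
      · by_cases hjq : j = q
        · subst hjq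
          rw [Function.update_self, Function.update_of_ne hiq] at hij
          exact absurd hij (hr i (by omega))
        · rw [Function.update_of_ne hiq, Function.update_of_ne hjq] at hij
          exact hinj i (by omega) j (by omega) hij
    · intro j hj
      by_cases hjq : j = q
      · subst hjq
        simpa using hrv
      · simpa [hjq] using hval j (by omega)
    · intro i hi j hj
      have hi' : ∀ j < q, a j ≠ i := by
        intro j hj
        have := hi j (by omega)
        rwa [Function.update_of_ne hj.ne] at this
      by_cases hjq : j = q
      · subst hjq
        rw [Function.update_self]
        rcases F'.eq_empty_or_nonempty with h | ⟨s, hs⟩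
        · exact Or.inl h
        · exact Or.inr ⟨s, hs, hminr i hi' s hs⟩
      · rw [Function.update_of_ne hjq]
        exact hrem i hi' j (by omega)

lemma core (k L : ℕ) (hL : 2 * k ≤ L) {ι : Type*} [Fintype ι] [DecidableEq ι] [Nonempty ι]
    (hcard : Fintype.card ι = k) (d : ℕ) (hkd : 3 * k ≤ 2 * d)
    (u : ι → ℕ → ℝ)
    (ha : ∀ i, Antitone (u i)) (h0 : ∀ i p, 0 ≤ u i p) (c : ι → ℕ → Fin d)
    (hc : ∀ i l, ∑ p ∈ range L with c i p = l, u i p = 1) :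
    ∃ f : ℕ → ι, ∀ i, 1 ≤ ∑ p ∈ range L with f p = i, u i p := by
  obtain ⟨a, S, hS, hdisj, -, hinj, hval, -⟩ :=
    fill_step k L hL hcard d hkd u ha h0 c hc k le_rfl
  have hS' : ∀ j, ∀ p ∈ S j, 2 * k ≤ p ∧ p < L := fun j p hp => mem_Ico.1 (hS j hp)
  have hf : ∀ p, ∃ r : ι, ∀ j < k, (p = j ∨ p = 2 * k - 1 - j ∨ p ∈ S j) → a j = r := by
    intro p
    by_cases hex : ∃ j < k, (p = j ∨ p = 2 * k - 1 - j ∨ p ∈ S j)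
    · obtain ⟨j, hj, hp⟩ := hex
      refine ⟨a j, ?_⟩
      intro j' hj' hp'
      congr 1
      by_contra hne
      rcases hp with hp | hp | hp <;> rcases hp' with hp' | hp' | hp'
      · omega
      · omega
      · have := hS' _ _ hp'; omega
      · omega
      · omega
      · have := hS' _ _ hp'; omega
      · have := hS' _ _ hp; omega
      · have := hS' _ _ hp; omega
      · exact disjoint_left.1 (hdisj j' j hne) hp' hp
    · refine ⟨Classical.arbitrary ι, ?_⟩
      intro j hj hp
      exact absurd ⟨j, hj, hp⟩ hex
  choose f hf using hf
  refine ⟨f, fun i => ?_⟩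
  have hi : ∃ j < k, a j = i := by
    have h1 : (range k).image a = univ := by
      apply eq_univ_of_card
      rw [card_image_of_injOn, card_range, hcard]
      intro x hx y hy hxy
      exact hinj x (by simpa using hx) y (by simpa using hy) hxy
    have h2 := mem_univ i
    rw [← h1, mem_image] at h2
    obtain ⟨j, hj, hji⟩ := h2
    exact ⟨j, mem_range.1 hj, hji⟩
  obtain ⟨j, hj, rfl⟩ := hi
  refine (hval j hj).trans ?_
  have hn1 : 2 * k - 1 - j ∉ S j := fun h => by have := hS' _ _ h; omega
  have hn2 : j ∉ insert (2 * k - 1 - j) (S j) := by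
    rw [mem_insert, not_or]
    exact ⟨by omega, fun h => by have := hS' _ _ h; omega⟩
  have : bagVal (u (a j)) k j (S j)
      = ∑ p ∈ insert j (insert (2 * k - 1 - j) (S j)), u (a j) p := by
    rw [sum_insert hn2, sum_insert hn1, bagVal, add_assoc]
  rw [this]
  apply sum_le_sum_of_subset_of_nonneg
  · intro p hp
    rw [mem_insert, mem_insert] at hp
    rw [mem_filter, mem_range]
    refine ⟨?_, (hf p j hj hp).symm⟩
    rcases hp with hp | hp | hp
    · omega
    · omega
    · exact (hS' _ _ hp).2
  · intro p _ _
    exact h0 _ _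

lemma exists_alloc {G ι : Type*} [Fintype G] [DecidableEq G] [Fintype ι] [DecidableEq ι]
    [Nonempty ι] (d : ℕ) (hd : 0 < d) (hkd : 3 * Fintype.card ι ≤ 2 * d)
    (w : ι → G → ℝ) (h0 : ∀ i g, 0 ≤ w i g) (P : ι → G → Fin d)
    (hP : ∀ i l, ∑ g with P i g = l, w i g = 1) :
    ∃ A : G → ι, ∀ i, 1 ≤ ∑ g with A g = i, w i g := by
  obtain ⟨m, hm⟩ : ∃ m, m = Fintype.card G := ⟨_, rfl⟩
  have hσ : ∀ i, ∃ σ : Fin m ≃ G, Antitone (fun x => w i (σ x)) := by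
    intro i
    let e : Fin m ≃ G := (Fintype.equivFinOfCardEq hm.symm).symm
    refine ⟨(Tuple.sort (fun x => - w i (e x))).trans e, ?_⟩
    have := Tuple.monotone_sort (fun x => - w i (e x))
    intro x y hxy
    have h := this hxy
    simp only [Function.comp] at h
    simp only [Equiv.trans_apply]
    linarith
  choose σ hσ using hσ
  let L := max m (2 * Fintype.card ι)
  let u : ι → ℕ → ℝ := fun i p => if h : p < m then w i (σ i ⟨p, h⟩) else 0
  let c : ι → ℕ → Fin d := fun i p => if h : p < m then P i (σ i ⟨p, h⟩) else ⟨0, hd⟩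
  have hsum : ∀ (i : ι) (Q : ℕ → Prop) [DecidablePred Q], ∑ p ∈ range L with Q p, u i p
      = ∑ x ∈ univ.filter (fun x : Fin m => Q (x : ℕ)), w i (σ i x) := by
    intro i Q _
    rw [sum_filter, sum_filter, ← sum_subset (range_subset_range.2 (le_max_left m _)),
      Finset.sum_range]
    · apply sum_congr rfl
      intro x _
      simp [u]
    · intro p _ hp
      rw [mem_range] at hp
      simp [u, hp]
  obtain ⟨f, hf⟩ := core (Fintype.card ι) L (le_max_right _ _) rfl d hkd u
    (by
      intro i p q hpq
      simp only [u]
      split_ifs with h1 h2 h2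
      · exact hσ i (show (⟨p, h2⟩ : Fin m) ≤ ⟨q, h1⟩ from hpq)
      · omega
      · exact h0 _ _
      · exact le_rfl)
    (by
      intro i p
      simp only [u]
      split_ifs
      · exact h0 _ _
      · exact le_rfl)
    c
    (by
      intro i l
      rw [hsum i (fun p => c i p = l), ← hP i l, sum_filter, sum_filter,
        ← Equiv.sum_comp (σ i)]
      apply sum_congr rfl
      intro x _
      simp [c])
  -- picking sequence, through Hall's theorem
  have hall := (Finset.all_card_le_biUnion_card_iff_exists_injective
    (fun x : Fin m => (Iic x).image (σ (f x)))).1 (by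
      intro s
      rcases s.eq_empty_or_nonempty with h | h
      · simp [h]
      · have h1 : s ⊆ Iic (s.max' h) := fun x hx => mem_Iic.2 (s.le_max' x hx)
        refine (card_le_card h1).trans ?_
        rw [← card_image_of_injective _ (σ (f (s.max' h))).injective]
        apply card_le_card
        exact subset_biUnion_of_mem (fun x : Fin m => (Iic x).image (σ (f x))) (s.max'_mem h))
  obtain ⟨π, hπinj, hπ⟩ := hall
  have hbij : Function.Bijective π := by
    rw [Fintype.bijective_iff_injective_and_card]
    exact ⟨hπinj, by simp [hm]⟩
  let τ : Fin m ≃ G := Equiv.ofBijective π hbij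
  refine ⟨fun g => f (τ.symm g), fun i => (hf i).trans ?_⟩
  rw [hsum i (fun p => f p = i), sum_filter, sum_filter, ← Equiv.sum_comp τ]
  apply sum_le_sum
  intro x _
  simp only [Equiv.symm_apply_apply]
  split_ifs with hx
  · obtain ⟨y, hy, hyx⟩ := mem_image.1 (hπ x)
    rw [hx] at hyx
    have : τ x = σ i y := hyx.symm
    rw [this]
    exact hσ i (mem_Iic.1 hy)
  · exact le_rfl

theorem stmt_0 {G : Type*} [Fintype G] [DecidableEq G] (n : ℕ) (hn : 0 < n)
    (v : Fin n → G → ℝ) (hv : ∀ i g, 0 ≤ v i g)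
    (N' : Finset (Fin n)) (hN' : N'.card = 2 * n / 3) :
    ∃ A : G → Fin n, ∀ i ∈ N', mms Finset.univ (v i) n hn ≤ bval (v i) A i := by
  classical
  have hb0 : ∀ (A : G → Fin n) i, 0 ≤ bval (v i) A i := fun A i =>
    sum_nonneg (fun g _ => hv i g)
  obtain ⟨N2, hN2⟩ : ∃ N2, N2 = N'.filter (fun i => 0 < mms Finset.univ (v i) n hn) := ⟨_, rfl⟩
  rcases N2.eq_empty_or_nonempty with hemp | hne
  · refine ⟨fun _ => ⟨0, hn⟩, fun i hi => le_trans ?_ (hb0 _ i)⟩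
    by_contra hcon
    have : i ∈ N2 := by rw [hN2, mem_filter]; exact ⟨hi, not_le.1 hcon⟩
    simp [hemp] at this
  have hpart : ∀ i, ∃ P : G → Fin n, ∀ l, mms Finset.univ (v i) n hn
      ≤ ∑ g with P g = l, v i g := by
    intro i
    have hsup := Finset.exists_mem_eq_sup' (s := (univ : Finset (G → Fin n)))
      ⟨fun _ => ⟨0, hn⟩, Finset.mem_univ _⟩ (fun P : G → Fin n =>
        Finset.univ.inf' ⟨⟨0, hn⟩, Finset.mem_univ _⟩ fun j : Fin n =>
          ∑ g ∈ univ.filter (fun g => P g = j), v i g)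
    obtain ⟨P, -, hP⟩ := hsup
    refine ⟨P, fun l => ?_⟩
    rw [mms, hP]
    exact Finset.inf'_le _ (mem_univ l)
  choose P hP using hpart
  have hpos : ∀ i : N2, 0 < mms Finset.univ (v i) n hn := by
    rintro ⟨i, hi⟩
    rw [hN2, mem_filter] at hi
    exact hi.2
  have : Nonempty N2 := hne.to_subtype
  have hcard : N2.card ≤ N'.card := by rw [hN2]; exact card_filter_le _ _
  obtain ⟨A, hA⟩ := exists_alloc (ι := N2) n hn (by rw [Fintype.card_coe]; omega)
    (fun i g => v i g / ∑ g' with P i g' = P i g, v i g')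
    (fun i g => div_nonneg (hv _ _) (sum_nonneg fun g _ => hv _ _))
    (fun i g => P i g)
    (by
      intro i l
      have h1 := (hpos i).trans_le (hP i l)
      rw [sum_congr rfl (g := fun g => v i g / ∑ g' with P i g' = l, v i g')]
      · rw [← sum_div, div_self h1.ne']
      · intro g hg
        rw [(mem_filter.1 hg).2])
  refine ⟨fun g => A g, fun i hi => ?_⟩
  by_cases hi2 : i ∈ N2
  · have h1 := hA ⟨i, hi2⟩
    have hp := hpos ⟨i, hi2⟩
    have h2 : ∑ g with A g = ⟨i, hi2⟩, v i g / ∑ g' with P i g' = P i g, v i g'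
        ≤ ∑ g with A g = ⟨i, hi2⟩, v i g / mms Finset.univ (v i) n hn := by
      apply sum_le_sum
      intro g _
      exact div_le_div_of_nonneg_left (hv _ _) hp (hP i _)
    have h3 := h1.trans h2
    rw [← sum_div, one_le_div hp] at h3
    have h4 : bval (v i) (fun g => (A g : Fin n)) i = ∑ g with A g = ⟨i, hi2⟩, v i g := by
      unfold bval
      congr 1
      ext g
      simp [Subtype.ext_iff]
    rw [h4]
    exact h3
  · refine le_trans ?_ (hb0 _ i)
    by_contra hcon
    exact hi2 (by rw [hN2, mem_filter]; exact ⟨hi, not_le.1 hcon⟩)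
end

section
/- For every fair-division instance with n ≥ 1 agents and additive nonnegative valuations, there exists an allocation (A_1, …, A_n) of all the goods such that v_i(A_i) ≥ MMS_i^{⌈3n/2⌉}(M) for every agent i ∈ N. -/
open Finset

/-- Bag filling with bags `k` holding a first good `f` and a second good `s`. -/
lemma bagfill {ι : Type*} [DecidableEq ι] [Nonempty ι] (μ : ι → ℝ) (f s a : ι → ℕ → ℝ)
    (ha : ∀ i r, 0 ≤ a i r) (hs : ∀ i k, 0 ≤ s i k) :
    ∀ (N : ℕ) (S : Finset ι) (K R : Finset ℕ), S.card = N → K.card = N →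
      (∀ i ∈ S, ∀ k ∈ K, f i k ≤ μ i) →
      (∀ i ∈ S, ∀ k ∈ K, ∀ r ∈ R, a i r ≤ s i k) →
      (∀ i ∈ S, N * μ i ≤ ∑ k ∈ K, f i k + ∑ r ∈ R, a i r) →
      ∃ (φ ψ : ℕ → ι), ∀ i ∈ S, ∃ k ∈ K, φ k = i ∧
        μ i ≤ f i k + s i k + ∑ r ∈ R.filter (fun r => ψ r = i), a i r := by
  intro N
  induction N with
  | zero =>
    intro S K R hS _ _ _ _
    rw [Finset.card_eq_zero] at hS
    subst hS
    exact ⟨fun _ => Classical.arbitrary ι, fun _ => Classical.arbitrary ι, by simp⟩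
  | succ N ih =>
    intro S K R hS hK hf hsa htot
    obtain ⟨k, hk⟩ : K.Nonempty := Finset.card_pos.mp (by omega)
    obtain ⟨i0, hi0⟩ : S.Nonempty := Finset.card_pos.mp (by omega)
    have hKe : (K.erase k).card = N := by rw [Finset.card_erase_of_mem hk]; omega
    have hex : ∃ c : ℕ, ∃ R' ⊆ R, R'.card = c ∧
        ∃ i ∈ S, μ i ≤ f i k + s i k + ∑ r ∈ R', a i r := by
      refine ⟨R.card, R, Finset.Subset.refl _, rfl, i0, hi0, ?_⟩
      have h1 := htot i0 hi0
      rw [← Finset.add_sum_erase K _ hk] at h1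
      have h2 : ∑ x ∈ K.erase k, f i0 x ≤ N * μ i0 := by
        have := Finset.sum_le_card_nsmul (K.erase k) (fun x => f i0 x) (μ i0)
          (fun x hx => hf i0 hi0 x (Finset.mem_of_mem_erase hx))
        rw [hKe, nsmul_eq_mul] at this
        exact this
      push_cast at h1
      have := hs i0 k
      linarith
    classical
    obtain ⟨R', hR', hc, i, hi, hsat⟩ := Nat.find_spec hex
    have hmin := fun c (h : c < Nat.find hex) => Nat.find_min hex h
    have hSe : (S.erase i).card = N := by rw [Finset.card_erase_of_mem hi]; omega
    have key : ∀ j ∈ S, f j k + ∑ r ∈ R', a j r ≤ μ j := by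
      intro j hj
      rcases R'.eq_empty_or_nonempty with h0 | ⟨r, hr⟩
      · subst h0
        simpa using hf j hj k hk
      · by_contra hcon
        push Not at hcon
        refine hmin (R'.erase r).card ?_ ⟨R'.erase r, (Finset.erase_subset _ _).trans hR', rfl,
          j, hj, ?_⟩
        · rw [← hc]; exact Finset.card_erase_lt_of_mem hr
        · rw [← Finset.add_sum_erase R' _ hr] at hcon
          have := hsa j hj k hk r (hR' hr)
          linarith
    obtain ⟨φ, ψ, h⟩ := ih (S.erase i) (K.erase k) (R \ R') hSe hKe
      (fun j hj x hx => hf j (Finset.mem_of_mem_erase hj) x (Finset.mem_of_mem_erase hx))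
      (fun j hj x hx r hr => hsa j (Finset.mem_of_mem_erase hj) x (Finset.mem_of_mem_erase hx) r
        (Finset.mem_sdiff.mp hr).1)
      (by
        intro j hj
        have hj' := Finset.mem_of_mem_erase hj
        have h1 := htot j hj'
        have h2 := key j hj'
        rw [← Finset.add_sum_erase K _ hk, ← Finset.sum_sdiff hR'] at h1
        push_cast at h1
        linarith)
    refine ⟨fun x => if x = k then i else φ x, fun r => if r ∈ R' then i else ψ r, ?_⟩
    intro j hj
    by_cases hji : j = i
    · subst hji
      refine ⟨k, hk, by simp, hsat.trans ?_⟩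
      gcongr
      · intro x _ _; exact ha _ _
      · intro x hx
        simp [hx, hR' hx]
    · obtain ⟨x, hx, hφ, hle⟩ := h j (Finset.mem_erase.mpr ⟨hji, hj⟩)
      refine ⟨x, Finset.mem_of_mem_erase hx, by simp [Finset.ne_of_mem_erase hx, hφ],
        hle.trans (le_of_eq ?_)⟩
      congr 1
      apply Finset.sum_congr _ (fun _ _ => rfl)
      ext r
      simp only [Finset.mem_filter, Finset.mem_sdiff]
      by_cases hr : r ∈ R'
      · simp [hr, Ne.symm hji]
      · simp [hr]

lemma bundle_ineq (c : ℕ) (θ μ : ℝ) (h1 : μ ≤ 2 * θ) (h2 : θ ≤ μ) :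
    ((c : ℝ) - 1) * (2 * θ - μ) ≤ max (c * θ - μ) 0 := by
  rcases c with _ | _ | c
  · apply le_max_of_le_right; push_cast; linarith
  · apply le_max_of_le_right; push_cast; linarith
  · apply le_max_of_le_left
    push_cast
    have : (0 : ℝ) ≤ c := Nat.cast_nonneg c
    nlinarith [mul_nonneg this (sub_nonneg.mpr h2)]

/-- The counting estimate for one agent. -/
lemma counting (n d L : ℕ) (hn : 1 ≤ n) (hd : 3 * n ≤ 2 * d) (hL : 2 * n ≤ L)
    (a : ℕ → ℝ) (hanti : Antitone a) (ha : ∀ j, 0 ≤ a j) (μ : ℝ) (Q : ℕ → Fin d)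
    (hQ : ∀ t, ∑ j ∈ (range L).filter (fun j => Q j = t), a j = μ) :
    a 0 ≤ μ ∧ n * μ ≤ ∑ j ∈ range n, a j + ∑ j ∈ Ico (2 * n) L, a j := by
  have h0 : a 0 ≤ μ := by
    rw [← hQ (Q 0)]
    exact Finset.single_le_sum (f := a) (fun j _ => ha j) (by simp; omega)
  refine ⟨h0, ?_⟩
  have htot : ∑ j ∈ range L, a j = d * μ := by
    rw [← Finset.sum_fiberwise (range L) Q a]
    simp [hQ]
  have hsplit : ∑ j ∈ range n, a j + ∑ j ∈ Ico n (2 * n), a j + ∑ j ∈ Ico (2 * n) L, a j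
      = d * μ := by
    rw [← htot, Finset.sum_range_add_sum_Ico a (by omega), Finset.sum_range_add_sum_Ico a hL]
  have hdR : (3 : ℝ) * n ≤ 2 * d := by exact_mod_cast hd
  suffices hmid : ∑ j ∈ Ico n (2 * n), a j ≤ (d - n) * μ by linarith
  set θ := a n with hθ
  have hθμ : θ ≤ μ := (hanti (Nat.zero_le n)).trans h0
  have hcard : (Ico n (2 * n)).card = n := by simp; omega
  have hμ : 0 ≤ μ := (ha 0).trans h0
  rcases le_total (2 * θ) μ with hcase | hcase
  · have := Finset.sum_le_card_nsmul (Ico n (2 * n)) a θ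
      (fun x hx => hanti (Finset.mem_Ico.mp hx).1)
    rw [hcard, nsmul_eq_mul] at this
    have hnn : (0 : ℝ) ≤ n := Nat.cast_nonneg n
    nlinarith
  · have e1 : ∑ j ∈ range (2 * n), max (θ - a j) 0 = n * θ - ∑ j ∈ Ico n (2 * n), a j := by
      rw [← Finset.sum_range_add_sum_Ico _ (show n ≤ 2 * n by omega)]
      have z : ∑ j ∈ range n, max (θ - a j) 0 = 0 := by
        apply Finset.sum_eq_zero
        intro j hj
        have := hanti (Finset.mem_range.mp hj).le
        exact max_eq_right (by linarith)
      have z2 : ∑ j ∈ Ico n (2 * n), max (θ - a j) 0 = ∑ j ∈ Ico n (2 * n), (θ - a j) := by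
        apply Finset.sum_congr rfl
        intro j hj
        have := hanti (Finset.mem_Ico.mp hj).1
        exact max_eq_left (by linarith)
      rw [z, z2, Finset.sum_sub_distrib, Finset.sum_const, hcard, nsmul_eq_mul]
      ring
    have e2 : ((2 * n : ℝ) - d) * (2 * θ - μ) ≤ ∑ j ∈ range (2 * n), max (θ - a j) 0 := by
      rw [← Finset.sum_fiberwise (range (2 * n)) Q]
      have hc : ((2 * n : ℝ) - d) * (2 * θ - μ) =
          ∑ t : Fin d, ((((range (2 * n)).filter (fun j => Q j = t)).card : ℝ) - 1)
            * (2 * θ - μ) := by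
        rw [← Finset.sum_mul, Finset.sum_sub_distrib]
        have := Finset.card_eq_sum_card_fiberwise (f := Q) (s := range (2 * n)) (t := univ)
          (by intro x _; simp)
        rw [Finset.card_range] at this
        rw [← Nat.cast_sum, ← this]
        simp
      rw [hc]
      apply Finset.sum_le_sum
      intro t _
      refine (bundle_ineq _ θ μ hcase hθμ).trans (max_le ?_ ?_)
      · have b1 : ∑ j ∈ (range (2 * n)).filter (fun j => Q j = t), a j ≤ μ := by
          rw [← hQ t]
          apply Finset.sum_le_sum_of_subset_of_nonneg
          · apply Finset.filter_subset_filter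
            exact Finset.range_subset_range.mpr hL
          · intro j _ _; exact ha j
        have b2 : ∑ j ∈ (range (2 * n)).filter (fun j => Q j = t), (θ - a j) ≤
            ∑ j ∈ (range (2 * n)).filter (fun j => Q j = t), max (θ - a j) 0 :=
          Finset.sum_le_sum (fun j _ => le_max_left _ _)
        rw [Finset.sum_sub_distrib, Finset.sum_const, nsmul_eq_mul] at b2
        linarith
      · exact Finset.sum_nonneg (fun j _ => le_max_right _ _)
    nlinarith [mul_nonneg (sub_nonneg.mpr hdR) (sub_nonneg.mpr hθμ)]

lemma normalize_val {G : Type*} [Fintype G] [DecidableEq G] {d : ℕ} (v : G → ℝ) (hv : ∀ g, 0 ≤ v g)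
    (μ : ℝ) (hμ : 0 ≤ μ) (P : G → Fin d)
    (hP : ∀ t, μ ≤ ∑ g ∈ univ.filter (fun g => P g = t), v g) :
    ∃ w : G → ℝ, (∀ g, 0 ≤ w g) ∧ (∀ g, w g ≤ v g) ∧
      ∀ t, ∑ g ∈ univ.filter (fun g => P g = t), w g = μ := by
  set V : Fin d → ℝ := fun t => ∑ g ∈ univ.filter (fun g => P g = t), v g with hV
  have hV0 : ∀ t, 0 ≤ V t := fun t => hμ.trans (hP t)
  refine ⟨fun g => v g * (μ / V (P g)), fun g => mul_nonneg (hv g) (div_nonneg hμ (hV0 _)),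
    fun g => mul_le_of_le_one_right (hv g) (div_le_one_of_le₀ (hP _) (hV0 _)), ?_⟩
  intro t
  have : ∑ g ∈ univ.filter (fun g => P g = t), v g * (μ / V (P g)) = V t * (μ / V t) := by
    rw [hV, Finset.sum_mul]
    apply Finset.sum_congr rfl
    intro g hg
    rw [(Finset.mem_filter.mp hg).2]
  rw [this]
  by_cases h : V t = 0
  · have : μ = 0 := le_antisymm (h ▸ hP t) hμ
    simp [this]
  · field_simp

/-- Picking in order: a system of distinct representatives. -/
lemma picking {G ι : Type*} [Fintype G] [DecidableEq G] {m : ℕ} (hm : Fintype.card G = m)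
    (σ : ι → Fin m ≃ G) (A : Fin m → ι) :
    ∃ π : Fin m ≃ G, ∀ j, ∃ j' ≤ j, π j = σ (A j) j' := by
  classical
  have hall := (Finset.all_card_le_biUnion_card_iff_exists_injective
    (fun j : Fin m => (Finset.Iic j).image (σ (A j)))).mp (by
      intro J
      rcases J.eq_empty_or_nonempty with h | h
      · simp [h]
      · have h1 : ((Finset.Iic (J.max' h)).image (σ (A (J.max' h)))).card ≤
            (J.biUnion fun j : Fin m => (Finset.Iic j).image (σ (A j))).card :=
          Finset.card_le_card (Finset.subset_biUnion_of_mem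
            (fun j : Fin m => (Finset.Iic j).image (σ (A j))) (J.max'_mem h))
        rw [Finset.card_image_of_injective _ (σ _).injective] at h1
        refine le_trans (Finset.card_le_card ?_) h1
        intro j hj
        exact Finset.mem_Iic.mpr (J.le_max' j hj))
  obtain ⟨π, hinj, hπ⟩ := hall
  have hbij : Function.Bijective π :=
    (Fintype.bijective_iff_injective_and_card π).mpr ⟨hinj, by simp [hm]⟩
  refine ⟨Equiv.ofBijective π hbij, fun j => ?_⟩
  have := hπ j
  rw [Finset.mem_image] at this
  obtain ⟨j', hj', e⟩ := this
  exact ⟨j', Finset.mem_Iic.mp hj', e.symm⟩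

lemma sorting {G : Type*} [Fintype G] {m : ℕ} (hm : Fintype.card G = m) (w : G → ℝ) :
    ∃ σ : Fin m ≃ G, Antitone (fun j => w (σ j)) := by
  let e : Fin m ≃ G := (Fintype.equivFinOfCardEq hm).symm
  refine ⟨(Tuple.sort (fun j => - w (e j))).trans e, ?_⟩
  intro x y hxy
  have := Tuple.monotone_sort (fun j => - w (e j)) hxy
  simpa using this

lemma sum_pad {m L : ℕ} (hmL : m ≤ L) (b : Fin m → ℝ) (p : ℕ → Prop) [DecidablePred p] :
    ∑ j ∈ (range L).filter p, (if h : j < m then b ⟨j, h⟩ else 0) =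
      ∑ j ∈ univ.filter (fun j : Fin m => p j), b j := by
  rw [Finset.sum_filter, Finset.sum_filter, ← Finset.sum_range_add_sum_Ico _ hmL,
    Finset.sum_range]
  rw [Finset.sum_eq_zero (s := Ico m L), add_zero]
  · apply Finset.sum_congr rfl
    intro j _
    simp
  · intro j hj
    have := (Finset.mem_Ico.mp hj).1
    rw [dif_neg (by omega)]
    simp

lemma mms_spec {G : Type*} [Fintype G] [DecidableEq G] (w : G → ℝ) (hw : ∀ g, 0 ≤ w g)
    (k : ℕ) (hk : 0 < k) :
    0 ≤ mms Finset.univ w k hk ∧ ∃ P : G → Fin k,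
      ∀ t, mms Finset.univ w k hk ≤ ∑ g ∈ univ.filter (fun g => P g = t), w g := by
  have hne : (Finset.univ : Finset (G → Fin k)).Nonempty := ⟨fun _ => ⟨0, hk⟩, Finset.mem_univ _⟩
  have hne' : (Finset.univ : Finset (Fin k)).Nonempty := ⟨⟨0, hk⟩, Finset.mem_univ _⟩
  have hP := Finset.exists_mem_eq_sup' hne (fun P : G → Fin k =>
      Finset.univ.inf' hne' fun j => ∑ g ∈ univ.filter (fun g => P g = j), w g)
  have hP' : ∃ P ∈ (Finset.univ : Finset (G → Fin k)), mms Finset.univ w k hk =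
    Finset.univ.inf' hne' fun j => ∑ g ∈ univ.filter (fun g => P g = j), w g := hP
  obtain ⟨P, -, h⟩ := hP'
  rw [h]
  refine ⟨?_, P, ?_⟩
  · apply Finset.le_inf'
    intro t _
    exact Finset.sum_nonneg (fun g _ => hw g)
  · intro t
    exact Finset.inf'_le (fun j => ∑ g ∈ univ.filter (fun g => P g = j), w g) (Finset.mem_univ t)

theorem stmt_1 {G : Type*} [Fintype G] [DecidableEq G] (n : ℕ) (hn : 1 ≤ n)
    (v : Fin n → G → ℝ) (hv : ∀ i g, 0 ≤ v i g) :
    ∃ A : G → Fin n, ∀ i,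
      mms Finset.univ (v i) ((3 * n + 1) / 2) (by omega) ≤ bval (v i) A i := by
  obtain ⟨d, hd⟩ : ∃ d, d = (3 * n + 1) / 2 := ⟨_, rfl⟩
  have hdpos : 0 < d := by omega
  set μ : Fin n → ℝ := fun i => mms Finset.univ (v i) ((3 * n + 1) / 2) (by omega) with hμdef
  have hμ : ∀ i, 0 ≤ μ i ∧ ∃ P : G → Fin d,
      ∀ t, μ i ≤ ∑ g ∈ univ.filter (fun g => P g = t), v i g := by
    subst hd
    intro i
    exact mms_spec (v i) (hv i) _ _
  have hw : ∀ i, ∃ (P : G → Fin d) (w : G → ℝ), (∀ g, 0 ≤ w g) ∧ (∀ g, w g ≤ v i g) ∧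
      ∀ t, ∑ g ∈ univ.filter (fun g => P g = t), w g = μ i := by
    intro i
    obtain ⟨h0, P, hP⟩ := hμ i
    obtain ⟨w, hw⟩ := normalize_val (v i) (hv i) (μ i) h0 P hP
    exact ⟨P, w, hw⟩
  choose P w hw0 hwv hwP using hw
  obtain ⟨m, hm⟩ : ∃ m, Fintype.card G = m := ⟨_, rfl⟩
  choose σ hσ using fun i => sorting hm (w i)
  obtain ⟨L, hmL, hL⟩ : ∃ L, m ≤ L ∧ 2 * n ≤ L := ⟨max m (2 * n), le_max_left _ _, le_max_right _ _⟩
  set a : Fin n → ℕ → ℝ := fun i j => if h : j < m then w i (σ i ⟨j, h⟩) else 0 with hadef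
  have ha : ∀ i j, 0 ≤ a i j := by
    intro i j
    simp only [hadef]
    split_ifs
    · exact hw0 _ _
    · exact le_rfl
  have hanti : ∀ i, Antitone (a i) := by
    intro i x y hxy
    by_cases hy : y < m
    · have hx : x < m := by omega
      simp only [hadef, hx, hy, dif_pos]
      exact hσ i (show (⟨x, hx⟩ : Fin m) ≤ ⟨y, hy⟩ from hxy)
    · have : a i y = 0 := by simp [hadef, hy]
      rw [this]; exact ha i x
  have hcount : ∀ i, a i 0 ≤ μ i ∧
      n * μ i ≤ ∑ j ∈ range n, a i j + ∑ j ∈ Ico (2 * n) L, a i j := by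
    intro i
    apply counting n d L hn (by omega) hL (a i) (hanti i) (ha i) (μ i)
      (fun j => if h : j < m then P i (σ i ⟨j, h⟩) else ⟨0, hdpos⟩)
    intro t
    simp only [hadef]
    rw [sum_pad hmL (fun j => w i (σ i j)), ← hwP i t, Finset.sum_filter, Finset.sum_filter,
      ← Equiv.sum_comp (σ i)]
    simp
  have : Nonempty (Fin n) := ⟨⟨0, hn⟩⟩
  obtain ⟨φ, ψ, hfill⟩ := bagfill μ a (fun i k => a i (n + k)) a ha (fun i k => ha i _) n univ
    (range n) (Ico (2 * n) L) (by simp) (by simp)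
    (fun i _ k _ => (hanti i (Nat.zero_le k)).trans (hcount i).1)
    (fun i _ k hk r hr => hanti i (by
      have := Finset.mem_range.mp hk
      have := (Finset.mem_Ico.mp hr).1
      omega))
    (fun i _ => (hcount i).2)
  let B : ℕ → Fin n := fun j => if j < n then φ j else if j < 2 * n then φ (j - n) else ψ j
  have hB : ∀ i, μ i ≤ ∑ j ∈ (range L).filter (fun j => B j = i), a i j := by
    intro i
    obtain ⟨k, hk, hφ, hle⟩ := hfill i (Finset.mem_univ i)
    have hk' := Finset.mem_range.mp hk
    refine hle.trans ?_
    have h1 : k ∉ insert (n + k) ((Ico (2 * n) L).filter (fun r => ψ r = i)) := by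
      simp; omega
    have h2 : n + k ∉ (Ico (2 * n) L).filter (fun r => ψ r = i) := by
      simp; omega
    have h3 : a i k + a i (n + k) + ∑ r ∈ (Ico (2 * n) L).filter (fun r => ψ r = i), a i r =
        ∑ r ∈ insert k (insert (n + k) ((Ico (2 * n) L).filter (fun r => ψ r = i))), a i r := by
      rw [Finset.sum_insert h1, Finset.sum_insert h2, add_assoc]
    rw [h3]
    apply Finset.sum_le_sum_of_subset_of_nonneg
    · intro r hr
      rw [Finset.mem_insert, Finset.mem_insert, Finset.mem_filter, Finset.mem_Ico] at hr
      rw [Finset.mem_filter, Finset.mem_range]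
      rcases hr with rfl | rfl | ⟨⟨hr1, hr2⟩, hr3⟩
      · exact ⟨by omega, by simp [B, hk', hφ]⟩
      · refine ⟨by omega, ?_⟩
        have q1 : ¬ (n + k < n) := by omega
        have q2 : n + k < 2 * n := by omega
        simp only [B, q1, q2, if_true, if_false, Nat.add_sub_cancel_left, hφ]
      · refine ⟨hr2, ?_⟩
        have q1 : ¬ (r < n) := by omega
        have q2 : ¬ (r < 2 * n) := by omega
        simp only [B, q1, q2, if_false, hr3]
    · intro j _ _; exact ha i j
  obtain ⟨π, hπ⟩ := picking hm σ (fun j : Fin m => B j)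
  refine ⟨fun g => B (π.symm g), fun i => ?_⟩
  refine (hB i).trans ?_
  simp only [hadef]
  rw [sum_pad hmL (fun j => w i (σ i j)), bval, Finset.sum_filter, Finset.sum_filter,
    ← Equiv.sum_comp π]
  apply Finset.sum_le_sum
  intro j _
  simp only [Equiv.symm_apply_apply]
  split_ifs with h
  · obtain ⟨j', hj', e⟩ := hπ j
    rw [e, h]
    exact (hσ i hj').trans (hwv i _)
  · exact le_rfl
end

section
/- For every fair-division instance with exactly 3 agents and additive nonnegative valuations, there exists an allocation (A_1, A_2, A_3) of all the goods such that v_i(A_i) ≥ MMS_i^4(M) for every agent i ∈ {1, 2, 3}. -/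
open Finset

theorem mms_spec_aux {G : Type*} [Fintype G] [DecidableEq G] (w : G → ℝ) (k : ℕ) (hk : 0 < k) :
    ∃ P : G → Fin k, ∀ j, mms Finset.univ w k hk ≤
      ∑ g ∈ Finset.univ.filter (fun g => P g = j), w g := by
  have key := Finset.exists_mem_eq_sup' (s := (Finset.univ : Finset (G → Fin k)))
    ⟨fun _ => ⟨0, hk⟩, Finset.mem_univ _⟩ (fun P : G → Fin k =>
    Finset.univ.inf' ⟨⟨0, hk⟩, Finset.mem_univ _⟩ fun j : Fin k =>
      ∑ g ∈ Finset.univ.filter (fun g => P g = j), w g)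
  rcases key with ⟨P, hk1⟩
  have hP := hk1.2
  refine ⟨P, fun j => ?_⟩
  unfold mms
  refine hP.le.trans ?_
  exact Finset.inf'_le _ (Finset.mem_univ j)

/-- Splitting a set whose value exceeds twice the target by the largest item. -/
theorem cut_aux {G : Type*} [DecidableEq G] (w : G → ℝ) 
    (T : Finset G) (t c : ℝ) (ht : 0 < t) (hc : 0 ≤ c) (hx : ∀ g ∈ T, w g ≤ c)
    (hT : 2 * t + c ≤ ∑ g ∈ T, w g) :
    ∃ B ⊆ T, t ≤ ∑ g ∈ B, w g ∧ t ≤ ∑ g ∈ T \ B, w g := by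
  obtain ⟨B, hB, hmin⟩ := Finset.exists_min_image
    (T.powerset.filter (fun B => t ≤ ∑ g ∈ B, w g)) Finset.card
    ⟨T, by simp; linarith⟩
  simp only [mem_filter, mem_powerset] at hB hmin
  refine ⟨B, hB.1, hB.2, ?_⟩
  have hne : B.Nonempty := by
    rw [Finset.nonempty_iff_ne_empty]
    rintro rfl
    simp at hB
    linarith
  obtain ⟨g, hg⟩ := hne
  have h1 : ∑ x ∈ B.erase g, w x < t := by
    by_contra! h
    have := hmin (B.erase g) ⟨(Finset.erase_subset _ _).trans hB.1, h⟩
    have := Finset.card_erase_lt_of_mem hg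
    omega
  have h2 := Finset.add_sum_erase B w hg
  have h3 := Finset.sum_sdiff (f := w) hB.1
  have h4 := hx g (hB.1 hg)
  linarith

/-- Cut and choose for the two agents other than `i`. -/
theorem choose_aux {G : Type*} [Fintype G] [DecidableEq G]
    (v : Fin 3 → G → ℝ) (t : Fin 3 → ℝ) (i : Fin 3) (S : Finset G)
    (hS : t i ≤ ∑ g ∈ S, v i g)
    (hcut : ∀ j, ∃ B ⊆ Sᶜ, t j ≤ ∑ g ∈ B, v j g ∧ t j ≤ ∑ g ∈ Sᶜ \ B, v j g) :
    ∃ A : G → Fin 3, ∀ i, t i ≤ bval (v i) A i := by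
  obtain ⟨j, k, hij, hik, hjk, hall⟩ : ∃ j k : Fin 3, i ≠ j ∧ i ≠ k ∧ j ≠ k ∧
      ∀ l, l = i ∨ l = j ∨ l = k := by
    clear hS
    revert i
    decide
  have key : ∃ B ⊆ Sᶜ, t j ≤ ∑ g ∈ B, v j g ∧ t k ≤ ∑ g ∈ Sᶜ \ B, v k g := by
    obtain ⟨B, hB, h1, h2⟩ := hcut j
    obtain ⟨C, hC, h3, h4⟩ := hcut k
    have e1 := Finset.sum_sdiff (f := v k) hB
    have e2 := Finset.sum_sdiff (f := v k) hC
    by_cases h : t k ≤ ∑ g ∈ Sᶜ \ B, v k g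
    · exact ⟨B, hB, h1, h⟩
    · refine ⟨Sᶜ \ B, Finset.sdiff_subset, h2, ?_⟩
      rw [Finset.sdiff_sdiff_eq_self hB]
      linarith
  obtain ⟨B, hB, h1, h2⟩ := key
  have hB' : ∀ g ∈ B, g ∉ S := fun g hg => by simpa using hB hg
  refine ⟨fun g => if g ∈ S then i else if g ∈ B then j else k, fun l => ?_⟩
  unfold bval
  rcases hall l with rfl | rfl | rfl
  · convert hS using 2
    ext g
    simp only [mem_filter, mem_univ, true_and]
    split_ifs <;> simp_all [eq_comm]
  · convert h1 using 2
    ext g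
    have hBg : g ∈ S → g ∉ B := fun hs hb => hB' g hb hs
    clear hB' hB h2
    simp only [mem_filter, mem_univ, true_and]
    split_ifs <;> simp_all [eq_comm]
  · convert h2 using 2
    ext g
    simp only [mem_filter, mem_univ, true_and, mem_sdiff, mem_compl]
    split_ifs <;> simp_all [eq_comm]

theorem stmt_3 {G : Type*} [Fintype G] [DecidableEq G]
    (v : Fin 3 → G → ℝ) (hv : ∀ i g, 0 ≤ v i g) :
    ∃ A : G → Fin 3, ∀ i, mms Finset.univ (v i) 4 (by norm_num) ≤ bval (v i) A i := by
  set t : Fin 3 → ℝ := fun i => mms Finset.univ (v i) 4 (by norm_num) with ht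
  change ∃ A : G → Fin 3, ∀ i, t i ≤ bval (v i) A i
  have hP : ∀ i, ∃ P : G → Fin 4, ∀ j, t i ≤
      ∑ g ∈ Finset.univ.filter (fun g => P g = j), v i g :=
    fun i => mms_spec_aux (v i) 4 (by norm_num)
  clear_value t
  have htot : ∀ i, 4 * t i ≤ ∑ g, v i g := by
    intro i
    obtain ⟨P, hP⟩ := hP i
    have h := Finset.sum_fiberwise (Finset.univ : Finset G) P (v i)
    rw [Fin.sum_univ_four] at h
    linarith [hP 0, hP 1, hP 2, hP 3]
  have hex : ∃ S : Finset G, ∃ i, t i ≤ ∑ g ∈ S, v i g := by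
    obtain ⟨P, hP⟩ := hP 0
    exact ⟨_, 0, hP 0⟩
  obtain ⟨S0, hS0⟩ := hex
  obtain ⟨S, hS, hmin⟩ := Finset.exists_min_image
    (Finset.univ.filter (fun S : Finset G => ∃ i, t i ≤ ∑ g ∈ S, v i g)) Finset.card
    ⟨S0, by simpa using hS0⟩
  simp only [mem_filter, mem_univ, true_and] at hS hmin
  have hlt : ∀ R : Finset G, R.card < S.card → ∀ j, ∑ g ∈ R, v j g < t j := by
    intro R hR j
    by_contra! h
    have := hmin R ⟨j, h⟩
    omega
  obtain ⟨i, hi⟩ := hS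
  refine choose_aux v t i S hi fun j => ?_
  by_cases hc : S.card ≤ 2
  · obtain ⟨P, hP⟩ := hP j
    have hcard : 1 < ((S.image P)ᶜ).card := by
      rw [Finset.card_compl, Fintype.card_fin]
      have := Finset.card_image_le (s := S) (f := P)
      omega
    obtain ⟨a, ha, b, hb, hab⟩ := Finset.one_lt_card.mp hcard
    simp only [mem_compl, mem_image, not_exists, not_and] at ha hb
    refine ⟨Finset.univ.filter (fun g => P g = a), ?_, hP a, (hP b).trans ?_⟩
    · intro g hg
      simp only [mem_filter, mem_univ, true_and] at hg
      exact Finset.mem_compl.mpr fun h => ha g h hg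
    · refine Finset.sum_le_sum_of_subset_of_nonneg ?_ fun g _ _ => hv j g
      intro g hg
      simp only [mem_filter, mem_univ, true_and] at hg
      simp only [mem_sdiff, mem_compl, mem_filter, mem_univ, true_and]
      exact ⟨fun h => hb g h hg, fun h => hab (h.symm.trans hg)⟩
  · push Not at hc
    obtain ⟨g, hg⟩ : S.Nonempty := Finset.card_pos.mp (by omega)
    have h0 := hlt ∅ (by rw [Finset.card_empty]; omega) j
    have h1 := hlt {g} (by simp; omega) j
    have h2 := hlt (S.erase g) (Finset.card_erase_lt_of_mem hg) j
    have h3 := Finset.add_sum_erase S (v j) hg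
    have h4 := Finset.sum_add_sum_compl S (v j)
    have h5 := htot j
    simp only [sum_empty, sum_singleton] at h0 h1
    refine cut_aux (v j) Sᶜ (t j) (t j - v j g) h0 (by linarith) ?_ (by linarith)
    intro x hx
    have hgx : g ≠ x := by
      rintro rfl
      exact (Finset.mem_compl.mp hx) hg
    have h6 := hlt {g, x} (by rw [Finset.card_pair hgx]; omega) j
    rw [Finset.sum_pair hgx] at h6
    linarith
end

section
/- There exists a constant C > 0 such that for every n ≥ 4 there exists a fair-division instance with n agents, at most C·n² goods, additive nonnegative valuations, and MMS_i^n(M) > 0 for every agent i, with the following property: every optimal-MMS allocation A satisfies |{i ∈ N : v_i(A_i) ≥ MMS_i^n(M)}| ≤ 3 if n is even, and ≤ 4 if n is odd. -/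
open Finset

namespace MMSProof

/-- Value of the fibre `A ⁻¹ i`, over any finite set of goods. -/
noncomputable def fs {G K R : Type*} [Fintype G] [DecidableEq K] [AddCommMonoid R]
    (w : G → R) (A : G → K) (i : K) : R :=
  ∑ g, if A g = i then w g else 0

/-- Rationally independent reals in prescribed ranges. -/
lemma exists_indep {ι : Type} [Fintype ι] (a : ι → ℝ) (ha : ∀ i, 0 < a i) :
    ∃ x : ι → ℝ, LinearIndependent ℚ x ∧ ∀ i, a i < x i ∧ x i < 2 * a i := by
  classical
  have hr : Module.rank ℚ ℝ = Cardinal.continuum := Real.rank_rat_real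
  have h1 : Cardinal.lift.{0} (Cardinal.mk ι) ≤ Cardinal.lift.{0} (Module.rank ℚ ℝ) := by
    rw [hr, Cardinal.lift_id, Cardinal.lift_id]
    exact (Cardinal.lt_aleph0_of_finite ι).le.trans Cardinal.aleph0_le_continuum
  let B := Module.Basis.ofVectorSpace ℚ ℝ
  have h2 : Cardinal.mk ι ≤ Cardinal.mk (Module.Basis.ofVectorSpaceIndex ℚ ℝ) := by
    have := B.mk_eq_rank''
    rw [this]; simpa using h1
  obtain ⟨f⟩ := h2
  have hli : LinearIndependent ℚ (fun i => B (f i)) := B.linearIndependent.comp _ f.injective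
  have hne : ∀ i, B (f i) ≠ 0 := fun i => B.ne_zero _
  have hq : ∀ i, ∃ q : ℚ, q ≠ 0 ∧ a i < q * B (f i) ∧ q * B (f i) < 2 * a i := by
    intro i
    rcases lt_or_gt_of_ne (hne i) with h | h
    · obtain ⟨q, h1, h2⟩ := exists_rat_btwn (show 2 * a i / B (f i) < a i / B (f i) by
        rw [div_lt_div_right_of_neg h]; linarith [ha i])
      rw [div_lt_iff_of_neg h] at h1
      rw [lt_div_iff_of_neg h] at h2
      refine ⟨q, ?_, h2, h1⟩
      rintro rfl
      simp at h2; linarith [ha i]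
    · obtain ⟨q, h1, h2⟩ := exists_rat_btwn (show a i / B (f i) < 2 * a i / B (f i) by
        rw [div_lt_div_iff_of_pos_right h]; linarith [ha i])
      rw [div_lt_iff₀ h] at h1
      rw [lt_div_iff₀ h] at h2
      refine ⟨q, ?_, h1, h2⟩
      rintro rfl
      simp at h1; linarith [ha i]
  choose q hq0 hq1 using hq
  refine ⟨fun i => q i * B (f i), ?_, hq1⟩
  have := hli.units_smul (fun i => Units.mk0 (q i) (hq0 i))
  convert this using 1
  ext i
  simp [Units.smul_def, Rat.smul_def]

lemma exists_gap {α : Type*} [Finite α] (f : α → ℝ) :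
    ∃ γ : ℝ, 0 < γ ∧ ∀ a, 0 < f a → γ ≤ f a := by
  classical
  have : Fintype α := Fintype.ofFinite α
  have key : ∀ s : Finset α, ∃ γ : ℝ, 0 < γ ∧ ∀ a ∈ s, 0 < f a → γ ≤ f a := by
    intro s
    induction s using Finset.induction_on with
    | empty => exact ⟨1, one_pos, by simp⟩
    | insert a s _ ih =>
      obtain ⟨γ, h0, h⟩ := ih
      by_cases ha : 0 < f a
      · refine ⟨min γ (f a), lt_min h0 ha, ?_⟩
        intro b hb hfb
        rcases Finset.mem_insert.1 hb with rfl | hb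
        · exact min_le_right _ _
        · exact (min_le_left _ _).trans (h b hb hfb)
      · refine ⟨γ, h0, ?_⟩
        intro b hb hfb
        rcases Finset.mem_insert.1 hb with rfl | hb
        · exact absurd hfb ha
        · exact h b hb hfb
  obtain ⟨γ, h0, h⟩ := key Finset.univ
  exact ⟨γ, h0, fun a => h a (Finset.mem_univ _)⟩

/-- Goods: `n = N+1` big ones, and two families of small ones. -/
abbrev Gd (N : ℕ) := Fin (N + 1) ⊕ ((Fin N × Fin (N + 1)) ⊕ (Fin N × Fin (N + 1)))

/-- Index set of the rationally independent parameters. -/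
abbrev Ix (N : ℕ) := Option (Fin N ⊕ (Fin N × Fin (N + 1)))

/-- The part of partition `j` that contains the small good `y`. -/
def ph {N : ℕ} (l0 : Fin N) (y : Fin N × Fin (N + 1)) (j : Fin (N + 1)) : Fin N :=
  if j = y.2 then y.1 else l0

/-- Coefficients of the base valuation. -/
def co {N : ℕ} (l0 : Fin N) : Gd N → Ix N → ℚ
  | .inl _, none => 1
  | .inl m, some (.inl l) => if m = 0 then -(N : ℚ) else if m = l.succ then -1 else 0
  | .inl m, some (.inr _) => if m = 0 then (N : ℚ) else 0
  | .inr (.inl _), none => 0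
  | .inr (.inl s), some (.inl l) => if s.1 = l then 1 else 0
  | .inr (.inl s), some (.inr y) => if s.1 = ph l0 y s.2 then -1 else 0
  | .inr (.inr _), none => 0
  | .inr (.inr _), some (.inl _) => 0
  | .inr (.inr z), some (.inr y) => if z = y then 1 else 0

/-- Perturbation of agent `a`. -/
def pt {N : ℕ} (a : Fin (N + 1)) : Gd N → ℝ
  | .inl m => if m = 0 then 0 else -1
  | .inr (.inl s) => if s.2 = a then 1 else 0
  | .inr (.inr _) => 0

/-- The `j`-th exact partition. -/
def Pt {N : ℕ} (l0 : Fin N) (j : Fin (N + 1)) : Gd N → Fin (N + 1)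
  | .inl m => m
  | .inr (.inl s) => if s.2 = j then s.1.succ else 0
  | .inr (.inr y) => (ph l0 y j).succ

section coef
variable {N : ℕ} (l0 : Fin N) (A : Gd N → Fin (N + 1)) (i : Fin (N + 1))

lemma fs_none : fs (fun g => co l0 g none) A i = ∑ m, if A (.inl m) = i then 1 else 0 := by
  simp [fs, co]

lemma fs_del (l : Fin N) : fs (fun g => co l0 g (some (.inl l))) A i =
    (∑ j, if A (.inr (.inl (l, j))) = i then (1 : ℚ) else 0)
      - (if A (.inl l.succ) = i then 1 else 0) - (if A (.inl 0) = i then (N : ℚ) else 0) := by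
  simp only [fs, Fintype.sum_sum_type, co, Fintype.sum_prod_type, Fin.sum_univ_succ (n := N)]
  have h1 : ∀ x : Fin N, (if A (.inl x.succ) = i then
      if x.succ = 0 then -(N : ℚ) else if x.succ = l.succ then -1 else 0 else 0) =
      if x = l then (if A (.inl l.succ) = i then (-1 : ℚ) else 0) else 0 := by
    intro x
    by_cases h : x = l
    · subst h; simp
    · simp [h]
  rw [Finset.sum_congr rfl (fun x _ => h1 x)]
  simp only [Finset.sum_add_distrib]
  rw [Finset.sum_comm (s := (Finset.univ : Finset (Fin N))) (t := (Finset.univ : Finset (Fin N)))]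
  have h2 : ∀ (x : Fin N) (j : Fin (N + 1)), (if A (.inr (.inl (x, j))) = i then
      if x = l then (1 : ℚ) else 0 else 0) =
      if x = l then (if A (.inr (.inl (l, j))) = i then 1 else 0) else 0 := by
    intro x j
    by_cases h : x = l
    · subst h; simp
    · simp [h]
  simp only [h2]
  simp
  split_ifs <;> ring

lemma fs_y (y : Fin N × Fin (N + 1)) : fs (fun g => co l0 g (some (.inr y))) A i =
    (if A (.inr (.inr y)) = i then 1 else 0) + (if A (.inl 0) = i then (N : ℚ) else 0)
     - ∑ j, if A (.inr (.inl (ph l0 y j, j))) = i then (1 : ℚ) else 0 := by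
  simp only [fs, Fintype.sum_sum_type, co]
  have h1 : ∀ x : Fin N × Fin (N + 1), (if A (.inr (.inr x)) = i then
      if x = y then (1 : ℚ) else 0 else 0) =
      if x = y then (if A (.inr (.inr y)) = i then 1 else 0) else 0 := by
    intro x
    by_cases h : x = y
    · subst h; simp
    · simp [h]
  have h2 : ∀ (j : Fin (N + 1)) (x : Fin N), (if A (.inr (.inl (x, j))) = i then
      if x = ph l0 y j then (-1 : ℚ) else 0 else 0) =
      if x = ph l0 y j then (if A (.inr (.inl (ph l0 y j, j))) = i then -1 else 0) else 0 := by
    intro j x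
    by_cases h : x = ph l0 y j
    · subst h; simp
    · simp [h]
  have h3 : ∀ x : Fin (N + 1), (if A (.inl x) = i then
      if x = 0 then (N : ℚ) else 0 else 0) =
      if x = 0 then (if A (.inl 0) = i then (N : ℚ) else 0) else 0 := by
    intro x
    by_cases h : x = 0
    · subst h; simp
    · simp [h]
  simp only [h1, h3]
  rw [Fintype.sum_prod_type_right]
  simp only [h2]
  simp only [Finset.sum_ite_eq', Finset.mem_univ, if_true]
  have h4 : (∑ j, if A (.inr (.inl (ph l0 y j, j))) = i then (-1 : ℚ) else 0) =
      - ∑ j, if A (.inr (.inl (ph l0 y j, j))) = i then (1 : ℚ) else 0 := by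
    rw [← Finset.sum_neg_distrib]
    exact Finset.sum_congr rfl fun j _ => by split_ifs <;> simp
  rw [h4]; ring

lemma fs_pt (a : Fin (N + 1)) : fs (pt a) A i =
    (∑ l : Fin N, if A (.inr (.inl (l, a))) = i then (1 : ℝ) else 0)
      - ∑ l : Fin N, if A (.inl l.succ) = i then (1 : ℝ) else 0 := by
  simp only [fs, Fintype.sum_sum_type, pt, Fintype.sum_prod_type]
  rw [Fin.sum_univ_succ (n := N)]
  have h2 : ∀ (x : Fin N) (j : Fin (N + 1)), (if A (.inr (.inl (x, j))) = i then
      if j = a then (1 : ℝ) else 0 else 0) =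
      if j = a then (if A (.inr (.inl (x, a))) = i then 1 else 0) else 0 := by
    intro x j
    by_cases h : j = a
    · subst h; simp
    · simp [h]
  simp only [h2]
  simp only [Finset.sum_ite_eq', Finset.mem_univ, if_true, Fin.succ_ne_zero, if_false]
  have h4 : (∑ l : Fin N, if A (.inl l.succ) = i then (-1 : ℝ) else 0) =
      - ∑ l : Fin N, if A (.inl l.succ) = i then (1 : ℝ) else 0 := by
    rw [← Finset.sum_neg_distrib]
    exact Finset.sum_congr rfl fun j _ => by split_ifs <;> simp
  rw [h4]; simp; ring

lemma aux_sum (j : Fin (N + 1)) (f : Fin (N + 1) → Fin N) :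
    (∑ k, if (if k = j then (f k).succ else 0) = i then (1 : ℚ) else 0) =
      (if (f j).succ = i then 1 else 0) + (if 0 = i then (N : ℚ) else 0) := by
  rw [← Finset.add_sum_erase _ _ (Finset.mem_univ j)]
  congr 1
  · simp
  · rw [Finset.sum_congr rfl (g := fun _ => if 0 = i then (1 : ℚ) else 0)]
    · by_cases h : 0 = i <;> simp [h]
    · intro k hk
      simp [Finset.ne_of_mem_erase hk]

lemma fs_Pt (j : Fin (N + 1)) (e : Ix N) :
    fs (fun g => co l0 g e) (Pt l0 j) i = if e = none then 1 else 0 := by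
  rcases e with _ | l | y
  · rw [fs_none]
    change (∑ m, if m = i then (1 : ℚ) else 0) = 1
    simp
  · rw [fs_del]
    simp only [Pt]
    rw [aux_sum i j (fun _ => l)]
    split_ifs <;> simp_all
  · rw [fs_y]
    simp only [Pt]
    rw [aux_sum i j (fun k => ph l0 y k)]
    have h0 : (if (some (Sum.inr y) : Ix N) = none then (1 : ℚ) else 0) = 0 := if_neg (by simp)
    rw [h0]
    exact sub_self _

/-- The combinatorial core: exact allocations are the partitions `Pt`. -/
lemma core (hA : ∀ i e, fs (fun g => co l0 g e) A i = if e = none then 1 else 0) :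
    ∃ j : Fin (N + 1), ∀ a, a ≠ j → a ≠ A (.inl 0) → fs (pt a) A a ≤ -1 := by
  have hb : ∀ i, (Finset.univ.filter fun m => A (.inl m) = i).card = 1 := by
    intro i
    have := hA i none
    rw [fs_none] at this
    simpa using this
  have hinj : ∀ m m', A (.inl m) = A (.inl m') → m = m' := by
    intro m m' h
    exact Finset.card_le_one.1 (hb (A (.inl m'))).le m (by simp [h]) m' (by simp)
  have hsurj : ∀ i, ∃ m, A (.inl m) = i := by
    intro i
    have : (Finset.univ.filter fun m => A (.inl m) = i).Nonempty :=
      Finset.card_pos.1 (by rw [hb]; exact one_pos)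
    obtain ⟨m, hm⟩ := this
    exact ⟨m, by simpa using hm⟩
  have h0 : ∀ l : Fin N, A (.inl 0) ≠ A (.inl l.succ) := by
    intro l h
    exact (Fin.succ_ne_zero l) (hinj _ _ h).symm
  -- counts of the first family
  have hs : ∀ l l' : Fin N, (Finset.univ.filter fun j =>
      A (.inr (.inl (l', j))) = A (.inl l.succ)).card = if l' = l then 1 else 0 := by
    intro l l'
    have h := hA (A (.inl l.succ)) (some (.inl l'))
    rw [fs_del] at h
    simp only [h0, if_false, sub_zero, reduceCtorEq] at h
    rw [Finset.sum_boole, sub_eq_zero] at h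
    by_cases hl : l' = l
    · subst hl; simpa using h
    · rw [if_neg hl]
      rw [if_neg (fun hh => hl (Fin.succ_injective _ (hinj _ _ hh)))] at h
      exact_mod_cast h
  have hj : ∀ l : Fin N, ∃ j, ∀ k, A (.inr (.inl (l, k))) = A (.inl l.succ) ↔ k = j := by
    intro l
    have := hs l l
    rw [if_pos rfl, Finset.card_eq_one] at this
    obtain ⟨j, hj⟩ := this
    refine ⟨j, fun k => ?_⟩
    have := Finset.ext_iff.1 hj k
    simpa using this
  choose J hJ using hj
  have hy : ∀ l y, ph l0 y (J l) = l → A (.inr (.inr y)) = A (.inl l.succ) := by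
    intro l y hyl
    by_contra hne
    have h := hA (A (.inl l.succ)) (some (.inr y))
    rw [fs_y] at h
    simp only [h0, if_false, reduceCtorEq, hne, add_zero, zero_sub, neg_eq_zero] at h
    rw [Finset.sum_eq_zero_iff_of_nonneg (by intros; split_ifs <;> norm_num)] at h
    have := h (J l) (Finset.mem_univ _)
    rw [hyl, if_pos ((hJ l _).2 rfl)] at this
    exact one_ne_zero this
  have hc : ∀ l, J l = J l0 := by
    intro l
    by_contra hne
    have h1 := hy l (l, J l) (by simp [ph])
    have h2 := hy l0 (l, J l) (by simp [ph, Ne.symm hne])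
    have := Fin.succ_injective _ (hinj _ _ (h1.symm.trans h2))
    exact hne (by rw [this])
  refine ⟨J l0, fun a ha ha0 => ?_⟩
  obtain ⟨m, rfl⟩ := hsurj a
  rcases Fin.eq_zero_or_eq_succ m with rfl | ⟨l, rfl⟩
  · exact absurd rfl ha0
  rw [fs_pt]
  have e1 : (∑ l' : Fin N, if A (.inr (.inl (l', A (.inl l.succ)))) = A (.inl l.succ)
      then (1 : ℝ) else 0) = 0 := by
    refine Finset.sum_eq_zero fun l' _ => if_neg fun h => ?_
    by_cases hl : l' = l
    · subst hl
      have := (hJ l' _).1 h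
      exact ha (this.trans (hc l'))
    · have := hs l l'
      rw [if_neg hl, Finset.card_eq_zero] at this
      have h2 : A (.inl l.succ) ∈ (∅ : Finset (Fin (N + 1))) := by rw [← this]; simp [h]
      simp at h2
  have e2 : (1 : ℝ) ≤ ∑ l' : Fin N, if A (.inl l'.succ) = A (.inl l.succ) then (1 : ℝ) else 0 := by
    refine le_trans ?_ (Finset.single_le_sum (f := fun l' : Fin N =>
      if A (.inl l'.succ) = A (.inl l.succ) then (1 : ℝ) else 0)
      (by intros; split_ifs <;> norm_num) (Finset.mem_univ l))
    simp
  linarith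

end coef

/-- Base valuation. -/
noncomputable def bs {N : ℕ} (l0 : Fin N) (x : Ix N → ℝ) (g : Gd N) : ℝ :=
  ∑ e, (co l0 g e : ℝ) * x e

lemma fs_bs {N : ℕ} (l0 : Fin N) (x : Ix N → ℝ) (A : Gd N → Fin (N + 1)) (i : Fin (N + 1)) :
    fs (bs l0 x) A i = ∑ e, ((fs (fun g => co l0 g e) A i : ℚ) : ℝ) * x e := by
  simp only [fs, bs]
  push_cast
  simp only [Finset.sum_mul]
  rw [Finset.sum_comm]
  refine Finset.sum_congr rfl fun g _ => ?_
  split_ifs <;> simp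

lemma fs_add_mul {G K : Type*} [Fintype G] [DecidableEq K] (f h : G → ℝ) (η : ℝ) (A : G → K)
    (i : K) : fs (fun g => f g + η * h g) A i = fs f A i + η * fs h A i := by
  simp only [fs, Finset.mul_sum, ← Finset.sum_add_distrib]
  refine Finset.sum_congr rfl fun g _ => ?_
  split_ifs <;> simp

lemma sum_fs {G K : Type*} [Fintype G] [Fintype K] [DecidableEq K] (f : G → ℝ) (A : G → K) :
    ∑ i, fs f A i = ∑ g, f g := by
  simp only [fs]
  rw [Finset.sum_comm]
  simp

lemma exists_base {N : ℕ} (l0 : Fin N) : ∃ x : Ix N → ℝ, LinearIndependent ℚ x ∧ 1 < x none ∧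
    (∀ g, 0 ≤ bs l0 x g) ∧ ∀ l : Fin N, 1 / 2 ≤ bs l0 x (.inl l.succ) := by
  have hN : (1 : ℝ) ≤ N := by exact_mod_cast (Fin.pos l0)
  set K : ℝ := (N : ℝ) + 1 with hK
  have hK2 : 2 ≤ K := by linarith
  have hKK : 4 ≤ K ^ 2 := by nlinarith
  set a : ℝ := 1 / (2 * K ^ 2) with ha
  set c : ℝ := a / (2 * K ^ 2) with hc
  have ha0 : 0 < a := by positivity
  have hc0 : 0 < c := by positivity
  have ha1 : 2 * K ^ 2 * a = 1 := by rw [ha]; field_simp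
  have hc1 : 2 * K ^ 2 * c = a := by rw [hc]; field_simp
  obtain ⟨x, hx, hb⟩ := exists_indep (ι := Ix N)
    (fun e => match e with | none => 1 | some (.inl _) => a | some (.inr _) => c)
    (by rintro (_ | _ | _) <;> simp [ha0, hc0])
  have hu := hb none
  have hd := fun l => hb (some (.inl l))
  have hw := fun y => hb (some (.inr y))
  simp only at hu hd hw
  have hsw : ∑ y : Fin N × Fin (N + 1), x (some (.inr y)) ≤ a := by
    calc ∑ y : Fin N × Fin (N + 1), x (some (.inr y))
        ≤ ∑ y : Fin N × Fin (N + 1), 2 * c := Finset.sum_le_sum fun y _ => (hw y).2.le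
      _ = (N * (N + 1) : ℝ) * (2 * c) := by simp
      _ ≤ a := by rw [← hc1]; nlinarith
  have hsw0 : 0 ≤ ∑ y : Fin N × Fin (N + 1), x (some (.inr y)) :=
    Finset.sum_nonneg fun y _ => (hc0.trans (hw y).1).le
  have hsd : N * ∑ l : Fin N, x (some (.inl l)) ≤ 1 := by
    calc N * ∑ l : Fin N, x (some (.inl l))
        ≤ N * ∑ l : Fin N, 2 * a := by gcongr with l; exact (hd l).2.le
      _ = (N * N : ℝ) * (2 * a) := by simp; ring
      _ ≤ 1 := by rw [← ha1]; nlinarith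
  have hbd : ∀ l : Fin N, 1 / 2 ≤ bs l0 x (.inl l.succ) := by
    intro l
    have : bs l0 x (.inl l.succ) = x none - x (some (.inl l)) := by
      simp [bs, Fintype.sum_option, co, apply_ite (Rat.cast : ℚ → ℝ), sub_eq_add_neg]
    rw [this]
    have := hd l
    nlinarith
  refine ⟨x, hx, hu.1, ?_, hbd⟩
  rintro (m | s | y)
  · rcases Fin.eq_zero_or_eq_succ m with rfl | ⟨l, rfl⟩
    · have : bs l0 x (.inl 0) = x none - N * ∑ l : Fin N, x (some (.inl l))
          + N * ∑ y : Fin N × Fin (N + 1), x (some (.inr y)) := by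
        simp [bs, Fintype.sum_option, co, Finset.mul_sum]
        ring
      rw [this]
      nlinarith
    · linarith [hbd l]
  · have : bs l0 x (.inr (.inl s)) = x (some (.inl s.1))
        - ∑ y : Fin N × Fin (N + 1), if s.1 = ph l0 y s.2 then x (some (.inr y)) else 0 := by
      simp only [bs, Fintype.sum_option, co, Fintype.sum_sum_type, sub_eq_add_neg,
        ← Finset.sum_neg_distrib]
      rw [Rat.cast_zero, zero_mul, zero_add]
      congr 1
      · simp [apply_ite (Rat.cast : ℚ → ℝ)]
      · refine Finset.sum_congr rfl fun y _ => ?_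
        split_ifs <;> simp
    rw [this]
    have h2 : (∑ y : Fin N × Fin (N + 1), if s.1 = ph l0 y s.2 then x (some (.inr y)) else 0)
        ≤ ∑ y : Fin N × Fin (N + 1), x (some (.inr y)) := by
      refine Finset.sum_le_sum fun y _ => ?_
      split_ifs
      · exact le_rfl
      · exact (hc0.trans (hw y).1).le
    linarith [hd s.1]
  · have : bs l0 x (.inr (.inr y)) = x (some (.inr y)) := by
      simp [bs, Fintype.sum_option, co, apply_ite (Rat.cast : ℚ → ℝ)]
    rw [this]
    exact (hc0.trans (hw y).1).le

theorem main_inst {N : ℕ} (l0 : Fin N) :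
    ∃ (v : Fin (N + 1) → Gd N → ℝ) (u t : ℝ), 0 < u ∧ (∀ i g, 0 ≤ v i g) ∧
      (∀ i, ∃ P : Gd N → Fin (N + 1), ∀ j, fs (v i) P j = u) ∧
      (∃ B : Gd N → Fin (N + 1), ∀ i, t ≤ fs (v i) B i) ∧
      ∀ A : Gd N → Fin (N + 1), (∀ i, t ≤ fs (v i) A i) →
        ∃ a b, ∀ i, u ≤ fs (v i) A i → i = a ∨ i = b := by
  obtain ⟨x, hx, hu, hb0, hbd⟩ := exists_base l0
  set u := x none with hu_def
  obtain ⟨γ, hγ0, hγ⟩ := exists_gap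
    (fun q : (Gd N → Fin (N + 1)) × Fin (N + 1) => u - fs (bs l0 x) q.1 q.2)
  have hK : (0 : ℝ) < N + 1 := by positivity
  set η : ℝ := min (1 / 2) (γ / (2 * (N + 1))) with hη
  have hη0 : 0 < η := lt_min (by norm_num) (by positivity)
  have hη1 : η ≤ 1 / 2 := min_le_left _ _
  have hη2 : η * (N + 1) < γ := by
    have : η ≤ γ / (2 * (N + 1)) := min_le_right _ _
    rw [le_div_iff₀ (by positivity)] at this
    linarith
  have hbP : ∀ j i, fs (bs l0 x) (Pt l0 j) i = u := by
    intro j i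
    rw [fs_bs]
    simp only [fs_Pt]
    rw [Finset.sum_eq_single none] <;> simp +contextual [hu_def]
  refine ⟨fun a g => bs l0 x g + η * pt a g, u, u - η, by linarith, ?_, ?_, ?_, ?_⟩
  · rintro a (m | s | y)
    · rcases Fin.eq_zero_or_eq_succ m with rfl | ⟨l, rfl⟩
      · simpa [pt] using hb0 (.inl 0)
      · have := hbd l
        simp [pt]; linarith
    · have := hb0 (.inr (.inl s))
      have h2 : 0 ≤ pt a (.inr (.inl s)) := by simp only [pt]; split_ifs <;> norm_num
      positivity
    · simpa [pt] using hb0 (.inr (.inr y))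
  · intro i
    refine ⟨Pt l0 i, fun j => ?_⟩
    rw [fs_add_mul, hbP, fs_pt]
    have h0 : ∀ l : Fin N, Pt l0 i (.inr (.inl (l, i))) = Pt l0 i (.inl l.succ) := by
      intro l; simp [Pt]
    simp only [h0, sub_self, mul_zero, add_zero]
  · refine ⟨Pt l0 0, fun i => ?_⟩
    rw [fs_add_mul, hbP, fs_pt]
    have h1 : 0 ≤ ∑ l : Fin N, if Pt l0 0 (.inr (.inl (l, i))) = i then (1 : ℝ) else 0 :=
      Finset.sum_nonneg fun _ _ => by split_ifs <;> norm_num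
    have h2 : (∑ l : Fin N, if Pt l0 0 (.inl l.succ) = i then (1 : ℝ) else 0) ≤ 1 := by
      rw [Finset.sum_boole]
      have : (Finset.univ.filter fun l : Fin N => Pt l0 0 (.inl l.succ) = i).card ≤ 1 := by
        rw [Finset.card_le_one]
        intro l hl l' hl'
        have e1 : l.succ = i := (Finset.mem_filter.1 hl).2
        have e2 : l'.succ = i := (Finset.mem_filter.1 hl').2
        exact Fin.succ_injective _ (e1.trans e2.symm)
      exact_mod_cast this
    nlinarith
  · intro A hA
    have hge : ∀ i, u ≤ fs (bs l0 x) A i := by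
      intro i
      by_contra hlt
      have h1 := hγ (A, i) (by simpa using hlt)
      have h2 := hA i
      rw [fs_add_mul, fs_pt] at h2
      simp only at h1
      have h3 : (∑ l : Fin N, if A (.inr (.inl (l, i))) = i then (1 : ℝ) else 0) ≤ N := by
        calc _ ≤ ∑ l : Fin N, (1 : ℝ) := Finset.sum_le_sum fun _ _ => by split_ifs <;> norm_num
          _ = N := by simp
      have h4 : 0 ≤ ∑ l : Fin N, if A (.inl l.succ) = i then (1 : ℝ) else 0 :=
        Finset.sum_nonneg fun _ _ => by split_ifs <;> norm_num
      nlinarith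
    have heq : ∀ i, fs (bs l0 x) A i = u := by
      have htot : ∑ _i : Fin (N + 1), u = ∑ i, fs (bs l0 x) A i := by
        rw [sum_fs, ← sum_fs (bs l0 x) (Pt l0 0)]
        simp [hbP]
      have := (Finset.sum_eq_sum_iff_of_le (fun i _ => hge i)).1 htot
      exact fun i => (this i (Finset.mem_univ _)).symm
    have hco : ∀ i e, fs (fun g => co l0 g e) A i = if e = none then 1 else 0 := by
      intro i
      have h := heq i
      rw [fs_bs] at h
      have h2 : ∑ e, (fs (fun g => co l0 g e) A i - if e = none then 1 else 0) • x e = 0 := by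
        simp only [sub_smul, Finset.sum_sub_distrib, Rat.smul_def, h]
        rw [sub_eq_zero, Finset.sum_eq_single none] <;> simp +contextual [hu_def]
      intro e
      exact sub_eq_zero.1 (Fintype.linearIndependent_iff.1 hx _ h2 e)
    obtain ⟨j, hj⟩ := core l0 A hco
    refine ⟨j, A (.inl 0), fun i hi => ?_⟩
    by_contra hne
    push Not at hne
    have := hj i hne.1 hne.2
    rw [fs_add_mul, heq] at hi
    nlinarith

lemma bval_eq {G : Type*} [Fintype G] {n : ℕ} (w : G → ℝ) (A : G → Fin n) (i : Fin n) :
    bval w A i = fs w A i := by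
  simp [bval, fs, Finset.sum_filter]

lemma fs_equiv {G H K : Type*} [Fintype G] [Fintype H] [DecidableEq K] (e : G ≃ H)
    (w : H → ℝ) (A : G → K) (i : K) :
    fs (fun g => w (e g)) A i = fs w (fun h => A (e.symm h)) i := by
  simp only [fs]
  rw [← e.sum_comp]
  simp

lemma mms_eq {G : Type*} [Fintype G] [DecidableEq G] (w : G → ℝ) (n : ℕ) (hn : 0 < n) (u : ℝ)
    (P : G → Fin n) (hP : ∀ j, fs w P j = u) : mms Finset.univ w n hn = u := by
  apply le_antisymm
  · refine Finset.sup'_le _ _ fun Q _ => ?_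
    by_contra hlt
    push Not at hlt
    have h1 : ∀ j, u < fs w Q j := by
      intro j
      refine lt_of_lt_of_le hlt ((Finset.inf'_le _ (Finset.mem_univ j)).trans ?_)
      simp [fs, Finset.sum_filter]
    have h2 : ∑ _j : Fin n, u < ∑ j, fs w Q j :=
      Finset.sum_lt_sum_of_nonempty ⟨⟨0, hn⟩, Finset.mem_univ _⟩ fun j _ => h1 j
    rw [sum_fs, ← sum_fs w P] at h2
    simp [hP] at h2
  · refine le_trans ?_ (Finset.le_sup' _ (Finset.mem_univ P))
    refine Finset.le_inf' _ _ fun j _ => ?_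
    rw [← hP j]
    simp [fs, Finset.sum_filter]

end MMSProof

theorem stmt_4 :
    ∃ C : ℝ, 0 < C ∧ ∀ n : ℕ, ∀ hn : 4 ≤ n,
      ∃ (m : ℕ) (v : Fin n → Fin m → ℝ),
        (m : ℝ) ≤ C * (n : ℝ) ^ 2 ∧ (∀ i g, 0 ≤ v i g) ∧
        (∀ i, 0 < mms Finset.univ (v i) n (by omega)) ∧
        (∀ A : Fin m → Fin n,
          (∀ B : Fin m → Fin n,
            Finset.univ.inf' ⟨⟨0, by omega⟩, Finset.mem_univ _⟩
              (fun i => bval (v i) B i / mms Finset.univ (v i) n (by omega)) ≤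
            Finset.univ.inf' ⟨⟨0, by omega⟩, Finset.mem_univ _⟩
              (fun i => bval (v i) A i / mms Finset.univ (v i) n (by omega))) →
          (Finset.univ.filter
              (fun i => mms Finset.univ (v i) n (by omega) ≤ bval (v i) A i)).card ≤
            if n % 2 = 0 then 3 else 4) := by
  classical
  refine ⟨2, by norm_num, fun n hn => ?_⟩
  obtain ⟨N, rfl⟩ : ∃ N, n = N + 1 := ⟨n - 1, by omega⟩
  obtain ⟨v, u, t, hu, hv, hP, ⟨B, hB⟩, hA⟩ := MMSProof.main_inst (⟨0, by omega⟩ : Fin N)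
  let e := (Fintype.equivFin (MMSProof.Gd N)).symm
  have hm : ∀ i, mms Finset.univ (fun g => v i (e g)) (N + 1) (by omega) = u := by
    intro i
    obtain ⟨P, hP⟩ := hP i
    refine MMSProof.mms_eq _ _ _ u (fun g => P (e g)) fun j => ?_
    rw [MMSProof.fs_equiv]
    simpa using hP j
  refine ⟨Fintype.card (MMSProof.Gd N), fun i g => v i (e g), ?_, fun i g => hv i _, ?_, ?_⟩
  · simp only [Fintype.card_sum, Fintype.card_prod, Fintype.card_fin]
    push_cast
    nlinarith
  · intro i
    rw [hm]; exact hu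
  · intro A hopt
    simp only [hm] at hopt ⊢
    have h1 : ∀ i, t ≤ MMSProof.fs (v i) (fun h => A (e.symm h)) i := by
      intro i
      have h := hopt (fun g => B (e g))
      have h2 : t / u ≤ bval (fun g => v i (e g)) A i / u := by
        refine le_trans (le_trans ?_ h) (Finset.inf'_le _ (Finset.mem_univ i))
        refine Finset.le_inf' _ _ fun j _ => ?_
        rw [MMSProof.bval_eq, MMSProof.fs_equiv, div_le_div_iff_of_pos_right hu]
        simpa using hB j
      rwa [div_le_div_iff_of_pos_right hu, MMSProof.bval_eq, MMSProof.fs_equiv] at h2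
    obtain ⟨a, b, hab⟩ := hA _ h1
    have h3 : (Finset.univ.filter (fun i => u ≤ bval (fun g => v i (e g)) A i)) ⊆ {a, b} := by
      intro i hi
      have hi := (Finset.mem_filter.1 hi).2
      rw [MMSProof.bval_eq, MMSProof.fs_equiv] at hi
      simpa using hab i hi
    have h4 := (Finset.card_le_card h3).trans Finset.card_le_two
    split_ifs <;> omega
end

section
/- There exists a constant C > 0 such that for every n ≥ 4 and every integer d with 2 ≤ d ≤ ⌊n/2⌋ there exists a fair-division instance with n agents, at most C·d·n goods, additive nonnegative valuations, and MMS_i^n(M) > 0 for every agent i, with the following property: every optimal-MMS allocation A satisfies |{i ∈ N : v_i(A_i) ≥ MMS_i^n(M)}| ≤ ⌈n/d⌉ + 1. -/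
open Finset

abbrev Gd (d m : ℕ) : Type := Unit ⊕ Fin m ⊕ (Fin d × Fin m) ⊕ (Fin d × Fin m)

/-- generic one-step perturbation -/
theorem step_ev {G : Type*} [Fintype G] (f0 f : G → ℝ) (h0 : ∀ g, 0 < f0 g) :
    ∀ᶠ c in nhdsWithin (0:ℝ) (Set.Ioi 0), (∀ g, 0 < f0 g + c * f g) ∧
      ∀ S : Finset G, ∑ g ∈ S, (f0 g + c * f g) = 1 → ∑ g ∈ S, f0 g = 1 ∧ ∑ g ∈ S, f g = 0 := by
  refine Filter.Eventually.and ?_ ?_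
  · rw [Filter.eventually_all]
    intro g
    have : Filter.Tendsto (fun c : ℝ => f0 g + c * f g) (nhdsWithin 0 (Set.Ioi 0))
        (nhds (f0 g + 0 * f g)) :=
      (Continuous.tendsto (by fun_prop) 0).mono_left nhdsWithin_le_nhds
    exact this.eventually (lt_mem_nhds (by simpa using h0 g))
  · rw [Filter.eventually_all]
    intro S
    have hs : ∀ c : ℝ, ∑ g ∈ S, (f0 g + c * f g) = ∑ g ∈ S, f0 g + c * ∑ g ∈ S, f g := by
      intro c; rw [Finset.sum_add_distrib, Finset.mul_sum]
    simp only [hs]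
    by_cases h1 : ∑ g ∈ S, f0 g = 1
    · filter_upwards [self_mem_nhdsWithin] with c hc he
      refine ⟨h1, ?_⟩
      have hc' : c ≠ 0 := ne_of_gt hc
      have : c * ∑ g ∈ S, f g = 0 := by linarith
      exact (mul_eq_zero.mp this).resolve_left hc'
    · have : Filter.Tendsto (fun c : ℝ => ∑ g ∈ S, f0 g + c * ∑ g ∈ S, f g)
          (nhdsWithin 0 (Set.Ioi 0)) (nhds (∑ g ∈ S, f0 g + 0 * ∑ g ∈ S, f g)) :=
        (Continuous.tendsto (by fun_prop) 0).mono_left nhdsWithin_le_nhds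
      have h2 := this.eventually_ne (show ∑ g ∈ S, f0 g + 0 * ∑ g ∈ S, f g ≠ 1 by simpa using h1)
      filter_upwards [h2] with c hc he
      exact absurd he hc

theorem generic {G ι : Type*} [Fintype G] [DecidableEq ι] (f0 : G → ℝ) (f : ι → G → ℝ)
    (h0 : ∀ g, 0 < f0 g) (I : Finset ι) :
    ∃ c : ι → ℝ, (∀ g, 0 < f0 g + ∑ i ∈ I, c i * f i g) ∧
      ∀ S : Finset G, ∑ g ∈ S, (f0 g + ∑ i ∈ I, c i * f i g) = 1 →
        ∑ g ∈ S, f0 g = 1 ∧ ∀ i ∈ I, ∑ g ∈ S, f i g = 0 := by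
  induction I using Finset.induction_on with
  | empty => exact ⟨0, by simpa using h0, by simp⟩
  | insert a I ha ih =>
    obtain ⟨c, hc1, hc2⟩ := ih
    obtain ⟨t, ht1, ht2⟩ := (step_ev (fun g => f0 g + ∑ i ∈ I, c i * f i g) (f a) hc1).exists
    have key : ∀ g, f0 g + ∑ i ∈ insert a I, (Function.update c a t) i * f i g
        = (f0 g + ∑ i ∈ I, c i * f i g) + t * f a g := by
      intro g
      rw [Finset.sum_insert ha, Function.update_self]
      have : ∑ i ∈ I, Function.update c a t i * f i g = ∑ i ∈ I, c i * f i g := by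
        refine Finset.sum_congr rfl fun i hi => ?_
        rw [Function.update_of_ne (by rintro rfl; exact ha hi)]
      rw [this]; ring
    refine ⟨Function.update c a t, ?_, ?_⟩
    · intro g; rw [key]; exact ht1 g
    · intro S hS
      simp only [key] at hS
      obtain ⟨h1, h2⟩ := ht2 S hS
      obtain ⟨h3, h4⟩ := hc2 S h1
      refine ⟨h3, fun i hi => ?_⟩
      rcases Finset.mem_insert.mp hi with rfl | hi
      · exact h2
      · exact h4 i hi

def partn {d m : ℕ} [NeZero m] (j : Fin d) : Gd d m → Fin (m + 1)
  | .inl _ => 0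
  | .inr (.inl k) => k.succ
  | .inr (.inr (.inl p)) => if p.1 = j then p.2.succ else 0
  | .inr (.inr (.inr p)) => if p.1 = j then p.2.succ else (0 : Fin m).succ

/-- base count function -/
def hh {d m : ℕ} : Gd d m → ℝ
  | .inl _ => 1
  | .inr (.inl _) => 1
  | .inr (.inr (.inl _)) => 0
  | .inr (.inr (.inr _)) => 0

noncomputable def fa {d m : ℕ} (k : Fin m) : Gd d m → ℝ
  | .inl _ => -((d : ℝ) - 1)
  | .inr (.inl k') => if k' = k then -1 else 0
  | .inr (.inr (.inl p)) => if p.2 = k then 1 else 0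
  | .inr (.inr (.inr _)) => 0

noncomputable def fb {d m : ℕ} [NeZero m] (q : Fin d × Fin m) : Gd d m → ℝ
  | .inl _ => 0
  | .inr (.inl k') => if k' = 0 then -1 else 0
  | .inr (.inr (.inl p)) =>
      if p.1 = q.1 then (if p.2 = 0 then 1 else 0) - (if p.2 = q.2 then 1 else 0) else 0
  | .inr (.inr (.inr p)) => if p = q then 1 else 0

noncomputable def pp {d m : ℕ} (j : Fin d) : Gd d m → ℝ
  | .inl _ => ((d : ℝ) - 1) * m
  | .inr (.inl _) => 0
  | .inr (.inr (.inl p)) => if p.1 = j then 0 else -1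
  | .inr (.inr (.inr _)) => 0

theorem sum_zero {d m : ℕ} [NeZero m] (j : Fin d) (F : Gd d m → ℝ) :
    ∑ x ∈ univ.filter (fun x => partn j x = 0), F x =
      F (.inl ()) + ∑ l, if l = j then 0 else ∑ k, F (.inr (.inr (.inl (l, k)))) := by
  rw [Finset.sum_filter]
  simp only [Fintype.sum_sum_type, Fintype.sum_prod_type, partn]
  have h1 : ∀ (p : Prop) [Decidable p] (k k' : Fin m), ¬ ((if p then k.succ else k'.succ) = 0) := by
    intro p _ k k'; split_ifs <;> exact Fin.succ_ne_zero _
  have h2 : ∀ (l : Fin d) (k : Fin m), ((if l = j then k.succ else 0) = 0) ↔ ¬ l = j := by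
    intro l k; split_ifs with h <;> simp [h, Fin.succ_ne_zero]
  simp only [h1, h2, Fin.succ_ne_zero]
  simp only [if_false, Finset.sum_const_zero, add_zero, zero_add, if_true]
  simp only [Finset.univ_unique, Finset.sum_singleton]
  congr 1
  refine Finset.sum_congr rfl fun l _ => ?_
  by_cases h : l = j <;> simp [h]

theorem sum_succ' {d m : ℕ} [NeZero m] (j : Fin d) (F : Gd d m → ℝ) (b : Fin m) :
    ∑ x ∈ univ.filter (fun x => partn j x = b.succ), F x =
      F (.inr (.inl b)) + F (.inr (.inr (.inl (j, b)))) + F (.inr (.inr (.inr (j, b)))) +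
      if b = 0 then (∑ l, if l = j then 0 else ∑ k, F (.inr (.inr (.inr (l, k))))) else 0 := by
  rw [Finset.sum_filter]
  simp only [Fintype.sum_sum_type, Fintype.sum_prod_type, partn]
  have h1 : ∀ (l : Fin d) (k : Fin m), ((if l = j then k.succ else (0 : Fin m).succ) = b.succ) ↔
      (l = j ∧ k = b) ∨ (l ≠ j ∧ b = 0) := by
    intro l k; split_ifs with h
    · simp [h]
    · rw [Fin.succ_inj]; simp [h, eq_comm]
  have h2 : ∀ (l : Fin d) (k : Fin m), ((if l = j then k.succ else 0) = b.succ) ↔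
      (l = j ∧ k = b) := by
    intro l k; split_ifs with h <;> simp [h, (Fin.succ_ne_zero _).symm]
  simp only [h1, h2, Fin.succ_inj, (Fin.succ_ne_zero _).symm]
  simp only [if_false, Finset.sum_const_zero, zero_add, Finset.sum_ite_eq', Finset.mem_univ, if_true]
  have e1 : ∑ l : Fin d, ∑ k : Fin m, (if l = j ∧ k = b then F (.inr (.inr (.inl (l, k)))) else 0)
      = F (.inr (.inr (.inl (j, b)))) := by
    rw [Finset.sum_eq_single j, Finset.sum_eq_single b] <;> simp +contextual
  have e2 : ∑ l : Fin d, ∑ k : Fin m, (if (l = j ∧ k = b) ∨ (l ≠ j ∧ b = 0)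
        then F (.inr (.inr (.inr (l, k)))) else 0)
      = ∑ l : Fin d, ((if l = j then F (.inr (.inr (.inr (j, b)))) else 0) +
         if b = 0 then (if l = j then 0 else ∑ k, F (.inr (.inr (.inr (l, k))))) else 0) := by
    refine Finset.sum_congr rfl fun l _ => ?_
    by_cases h : l = j <;> by_cases hb : b = 0 <;> simp [h, hb]
  rw [e1, e2, Finset.sum_add_distrib]
  by_cases hb : b = 0 <;> simp [hb] <;> ring

theorem sum_ne {d : ℕ} (j : Fin d) (t : ℝ) :
    (∑ l : Fin d, if l = j then 0 else t) = ((d : ℝ) - 1) * t := by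
  have : ∀ l : Fin d, (if l = j then 0 else t) = t - if l = j then t else 0 := by
    intro l; split_ifs <;> ring
  simp only [this, Finset.sum_sub_distrib]
  simp; ring

theorem hh_bal {d m : ℕ} [NeZero m] (j : Fin d) (b : Fin (m+1)) :
    ∑ x ∈ univ.filter (fun x : Gd d m => partn j x = b), hh x = 1 := by
  refine Fin.cases ?_ (fun b => ?_) b
  · rw [sum_zero]; simp [hh]
  · rw [sum_succ']; simp [hh]

theorem fa_bal {d m : ℕ} [NeZero m] (j : Fin d) (k : Fin m) (b : Fin (m+1)) :
    ∑ x ∈ univ.filter (fun x : Gd d m => partn j x = b), fa k x = 0 := by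
  refine Fin.cases ?_ (fun b => ?_) b
  · rw [sum_zero]; simp [fa, sum_ne]
  · rw [sum_succ']; by_cases h : b = k <;> simp [fa, h]

theorem fb_bal {d m : ℕ} [NeZero m] (j : Fin d) (q : Fin d × Fin m) (b : Fin (m+1)) :
    ∑ x ∈ univ.filter (fun x : Gd d m => partn j x = b), fb q x = 0 := by
  obtain ⟨l, q⟩ := q
  refine Fin.cases ?_ (fun b => ?_) b
  · rw [sum_zero]
    simp only [fb, zero_add]
    refine Finset.sum_eq_zero fun l' _ => ?_
    by_cases h : l' = l <;> simp [h]
  · rw [sum_succ']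
    simp only [fb, Prod.mk.injEq]
    have e : (∑ l' : Fin d, if l' = j then (0:ℝ) else ∑ k : Fin m, if l' = l ∧ k = q then 1 else 0)
        = if l = j then 0 else 1 := by
      rw [Finset.sum_eq_single l]
      · simp
      · intro b _ hb; simp [hb]
      · simp
    rw [e]
    by_cases h : j = l
    · subst h
      simp only [if_true, true_and]
      split_ifs <;> simp
    · have h' : ¬ l = j := fun h' => h h'.symm
      by_cases hb : b = 0 <;> simp [hb, h, h']

theorem pp_bal {d m : ℕ} [NeZero m] (j : Fin d) (b : Fin (m+1)) :
    ∑ x ∈ univ.filter (fun x : Gd d m => partn j x = b), pp j x = 0 := by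
  refine Fin.cases ?_ (fun b => ?_) b
  · rw [sum_zero]
    simp only [pp]
    have : ∀ l : Fin d, (if l = j then (0:ℝ) else ∑ k : Fin m, if l = j then 0 else -1)
        = if l = j then 0 else -(m:ℝ) := by
      intro l; split_ifs <;> simp
    simp only [this, sum_ne]; ring
  · rw [sum_succ']; simp [pp]

theorem pp_ge {d m : ℕ} [NeZero m] (j j' : Fin d) (b : Fin (m+1)) :
    -1 ≤ ∑ x ∈ univ.filter (fun x : Gd d m => partn j x = b), pp j' x := by
  refine Fin.cases ?_ (fun b => ?_) b
  · rw [sum_zero]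
    simp only [pp]
    have : ∀ l : Fin d, (if l = j then (0:ℝ) else -(m:ℝ)) ≤ (if l = j then (0:ℝ) else ∑ k : Fin m, if l = j' then 0 else -1)
         := by
      intro l; split_ifs <;> simp
    have h2 := Finset.sum_le_sum (s := univ) (fun l _ => this l)
    rw [sum_ne] at h2
    linarith
  · rw [sum_succ']; simp [pp]; split_ifs <;> norm_num

/-- strictly positive base weights -/
noncomputable def f0 {d m : ℕ} [NeZero m] (x : Gd d m) : ℝ :=
  hh x + (1 / (2 * (d : ℝ) * m)) * ∑ k, fa k x + (1 / (4 * (d : ℝ) * m)) * ∑ q, fb q x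

theorem f0_pos {d m : ℕ} [NeZero m] (hd : 0 < d) (x : Gd d m) : 0 < f0 x := by
  have hd' : (0:ℝ) < d := by exact_mod_cast hd
  have hm' : (0:ℝ) < m := by exact_mod_cast Nat.pos_of_ne_zero (NeZero.ne m)
  have hd1 : (1:ℝ) ≤ d := by exact_mod_cast hd
  have hm1 : (1:ℝ) ≤ m := by exact_mod_cast Nat.pos_of_ne_zero (NeZero.ne m)
  rcases x with _ | k | ⟨l, k⟩ | q
  · simp only [f0, hh, fa, fb]
    simp
    field_simp
    nlinarith
  · simp only [f0, hh, fa, fb]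
    have : (∑ q : Fin d × Fin m, if k = 0 then (-1:ℝ) else 0) ≥ -(d * m) := by
      split_ifs <;> simp <;> positivity
    have h2 : (1 / (4 * (d:ℝ) * m)) * (∑ q : Fin d × Fin m, if k = 0 then (-1:ℝ) else 0)
        ≥ (1 / (4 * (d:ℝ) * m)) * -(d * m) := mul_le_mul_of_nonneg_left this (by positivity)
    have h3 : (1 / (4 * (d:ℝ) * m)) * -(d * m) = -1/4 := by field_simp
    have h4 : 1 / (2 * (d:ℝ) * m) ≤ 1 / 2 := by
      apply one_div_le_one_div_of_le <;> nlinarith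
    simp only [Finset.sum_ite_eq, Finset.mem_univ, if_true]
    linarith
  · simp only [f0, hh, fa, fb, Fintype.sum_prod_type]
    have : (∑ l' : Fin d, ∑ q : Fin m, if l = l' then ((if k = 0 then (1:ℝ) else 0) - if k = q then 1 else 0) else 0)
        ≥ -1 := by
      rw [Finset.sum_eq_single l]
      · simp; split_ifs <;> simp
      · intro b _ hb; simp [hb.symm]
      · simp
    have h2 := mul_le_mul_of_nonneg_left this (show 0 ≤ 1 / (4 * (d:ℝ) * m) by positivity)
    have h3 : 1 / (2 * (d:ℝ) * m) = 2 * (1 / (4 * (d:ℝ) * m)) := by field_simp; norm_num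
    have h4 : 0 < 1 / (4 * (d:ℝ) * m) := by positivity
    simp only [Finset.sum_ite_eq, Finset.mem_univ, if_true]
    linarith
  · simp only [f0, hh, fa, fb]
    simp
    positivity

theorem f0_sum {d m : ℕ} [NeZero m] (S : Finset (Gd d m)) :
    ∑ x ∈ S, f0 x = ∑ x ∈ S, hh x + (1 / (2 * (d : ℝ) * m)) * ∑ k, ∑ x ∈ S, fa k x
      + (1 / (4 * (d : ℝ) * m)) * ∑ q, ∑ x ∈ S, fb q x := by
  simp only [f0, Finset.sum_add_distrib, ← Finset.mul_sum]
  rw [Finset.sum_comm, Finset.sum_comm (s := S) (t := univ) (f := fun x q => fb q x)]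

/-- the base weight -/
theorem base_weight {d m : ℕ} [NeZero m] (hd : 0 < d) :
    ∃ w : Gd d m → ℝ, (∀ x, 0 < w x) ∧
      (∀ (j : Fin d) b, ∑ x ∈ univ.filter (fun x : Gd d m => partn j x = b), w x = 1) ∧
      ∀ S : Finset (Gd d m), ∑ x ∈ S, w x = 1 → ∑ x ∈ S, hh x = 1 ∧
        (∀ k, ∑ x ∈ S, fa k x = 0) ∧ (∀ q, ∑ x ∈ S, fb q x = 0) := by
  obtain ⟨c, h1, h2⟩ := generic (f0 (d := d) (m := m))
    (Sum.elim (fun k => fa k) (fun q => fb q)) (f0_pos hd) univ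
  refine ⟨_, h1, ?_, ?_⟩
  · intro j b
    rw [Finset.sum_add_distrib, f0_sum,
      Finset.sum_comm (f := fun x i => c i * Sum.elim (fun k => fa k) (fun q => fb q) i x)]
    simp only [← Finset.mul_sum, Fintype.sum_sum_type, Sum.elim_inl, Sum.elim_inr, fa_bal, fb_bal, hh_bal]
    simp
  · intro S hS
    obtain ⟨h3, h4⟩ := h2 S hS
    have ha : ∀ k, ∑ x ∈ S, fa k x = 0 := fun k => h4 (.inl k) (mem_univ _)
    have hb : ∀ q, ∑ x ∈ S, fb q x = 0 := fun k => h4 (.inr k) (mem_univ _)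
    refine ⟨?_, ha, hb⟩
    rw [f0_sum] at h3
    simpa [ha, hb] using h3

theorem sum_expand {d m : ℕ} (S : Finset (Gd d m)) (F : Gd d m → ℝ) :
    ∑ x ∈ S, F x = (if Sum.inl () ∈ S then F (.inl ()) else 0) +
      (∑ k, (if .inr (.inl k) ∈ S then F (.inr (.inl k)) else 0) +
      ((∑ l, ∑ k, if .inr (.inr (.inl (l, k))) ∈ S then F (.inr (.inr (.inl (l, k)))) else 0) +
      ∑ p, if .inr (.inr (.inr p)) ∈ S then F (.inr (.inr (.inr p))) else 0)) := by
  have h : ∑ x ∈ S, F x = ∑ x, if x ∈ S then F x else 0 := by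
    rw [← Finset.sum_filter]; simp
  rw [h]
  simp only [Fintype.sum_sum_type, Fintype.sum_prod_type, Finset.univ_unique, Finset.sum_singleton]

theorem struct_hub {d m : ℕ} [NeZero m] (S : Finset (Gd d m))
    (h1 : ∑ x ∈ S, hh x = 1) (h2 : ∀ k, ∑ x ∈ S, fa k x = 0) (h3 : ∀ q, ∑ x ∈ S, fb q x = 0)
    (hz : .inl () ∈ S) :
    ∃ j0 : Fin d, ∀ l, l ≠ j0 → ∀ k, .inr (.inr (.inl (l, k))) ∈ S := by
  have he : ∀ k, .inr (.inl k) ∉ S := by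
    rw [sum_expand] at h1
    simp only [hh, hz, if_true, ite_self, Finset.sum_const_zero, add_zero] at h1
    have h1' : ∑ k : Fin m, (if (.inr (.inl k) : Gd d m) ∈ S then (1:ℝ) else 0) = 0 := by linarith
    rw [Finset.sum_eq_zero_iff_of_nonneg (by intro i _; split_ifs <;> norm_num)] at h1'
    intro k hk
    simpa [hk] using h1' k (mem_univ _)
  have hc : (univ.filter (fun l : Fin d => ¬ .inr (.inr (.inl (l, (0 : Fin m)))) ∈ S)).card = 1 := by
    have := h2 0
    rw [sum_expand] at this
    simp only [fa, hz, he, if_true, if_false, ite_self, Finset.sum_const_zero, add_zero, zero_add] at this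
    have e : ∀ l : Fin d, (∑ k : Fin m, if (.inr (.inr (.inl (l, k))) : Gd d m) ∈ S then
        (if k = 0 then (1:ℝ) else 0) else 0) =
        1 - if ¬ (.inr (.inr (.inl (l, 0))) : Gd d m) ∈ S then 1 else 0 := by
      intro l
      rw [Finset.sum_eq_single 0]
      · by_cases h : (.inr (.inr (.inl (l, 0))) : Gd d m) ∈ S <;> simp [h]
      · intro b _ hb; simp [hb]
      · simp
    simp only [e, Finset.sum_sub_distrib, Finset.sum_boole] at this
    simp only [Finset.sum_const, Finset.card_univ, Fintype.card_fin, nsmul_eq_mul, mul_one] at this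
    have h5 : ((univ.filter (fun l : Fin d => ¬ .inr (.inr (.inl (l, (0 : Fin m)))) ∈ S)).card : ℝ) = 1 := by
      linarith
    exact_mod_cast h5
  obtain ⟨j0, hj0⟩ := Finset.card_eq_one.mp hc
  refine ⟨j0, fun l hl k => ?_⟩
  have hl0 : .inr (.inr (.inl (l, (0 : Fin m)))) ∈ S := by
    by_contra h
    have : l ∈ ({j0} : Finset (Fin d)) := by rw [← hj0]; simpa using h
    exact hl (by simpa using this)
  by_contra hk
  have := h3 (l, k)
  rw [sum_expand] at this
  simp only [fb, he, if_false, ite_self, Finset.sum_const_zero, zero_add] at this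
  have e : (∑ l' : Fin d, ∑ k' : Fin m, if (.inr (.inr (.inl (l', k'))) : Gd d m) ∈ S then
      (if l' = l then (if k' = 0 then (1:ℝ) else 0) - (if k' = k then 1 else 0) else 0) else 0) = 1 := by
    have e1 : ∀ k' : Fin m, (if (.inr (.inr (.inl (l, k'))) : Gd d m) ∈ S then
      ((if k' = 0 then (1:ℝ) else 0) - (if k' = k then 1 else 0)) else 0) = if k' = 0 then 1 else 0 := by
      intro k'
      by_cases h0 : k' = 0
      · subst h0
        have : (0 : Fin m) ≠ k := by rintro rfl; exact hk hl0
        simp [hl0, this]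
      · by_cases h1 : k' = k
        · subst h1; simp [hk, h0]
        · simp [h0, h1]
    rw [Finset.sum_eq_single l]
    · simp only [if_true, e1]; simp
    · intro b _ hb; simp [hb]
    · simp
  rw [e] at this
  have h6 : 0 ≤ ∑ p : Fin d × Fin m, if (.inr (.inr (.inr p)) : Gd d m) ∈ S then
      (if p = (l, k) then (1:ℝ) else 0) else 0 :=
    Finset.sum_nonneg (by intro i _; split_ifs <;> norm_num)
  linarith

theorem struct_nonhub {d m : ℕ} [NeZero m] (S : Finset (Gd d m))
    (h1 : ∑ x ∈ S, hh x = 1) (h2 : ∀ k, ∑ x ∈ S, fa k x = 0)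
    (hz : ¬ .inl () ∈ S) :
    ∃ l k, .inr (.inr (.inl (l, k))) ∈ S := by
  by_contra! hx
  have he : ∀ k, .inr (.inl k) ∉ S := by
    intro k hk
    have := h2 k
    rw [sum_expand] at this
    simp only [fa, hz, hx, if_false, ite_self, Finset.sum_const_zero, add_zero, zero_add] at this
    rw [Finset.sum_eq_single k] at this
    · simp [hk] at this
    · intro b _ hb; simp [hb]
    · simp
  rw [sum_expand] at h1
  simp [hh, hz, he] at h1

theorem pp_neg {d m : ℕ} (S : Finset (Gd d m)) (hz : ¬ .inl () ∈ S) (j l : Fin d) (k : Fin m)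
    (hl : l ≠ j) (hS : .inr (.inr (.inl (l, k))) ∈ S) : ∑ x ∈ S, pp j x < 0 := by
  refine Finset.sum_neg' ?_ ⟨_, hS, ?_⟩
  · rintro (_ | k | p | p) hx
    · exact absurd hx hz
    · simp [pp]
    · simp only [pp]; split_ifs <;> norm_num
    · simp [pp]
  · simp [pp, hl]

theorem small_c {d m : ℕ} (w : Gd d m → ℝ) (hw : ∀ x, 0 < w x) :
    ∃ c : ℝ, 0 < c ∧ (∀ (j : Fin d) x, 0 ≤ w x + c * pp j x) ∧
      ∀ (j : Fin d) (S : Finset (Gd d m)), ∑ x ∈ S, w x < 1 →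
        ∑ x ∈ S, (w x + c * pp j x) < 1 - c := by
  have key : ∀ᶠ c in nhdsWithin (0:ℝ) (Set.Ioi 0), 0 < c ∧ (∀ (j : Fin d) x, 0 ≤ w x + c * pp j x) ∧
      ∀ (j : Fin d) (S : Finset (Gd d m)), ∑ x ∈ S, w x < 1 →
        ∑ x ∈ S, (w x + c * pp j x) < 1 - c := by
    refine Filter.Eventually.and self_mem_nhdsWithin (Filter.Eventually.and ?_ ?_)
    · simp only [Filter.eventually_all]
      intro j x
      have : Filter.Tendsto (fun c : ℝ => w x + c * pp j x) (nhdsWithin 0 (Set.Ioi 0))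
          (nhds (w x + 0 * pp j x)) :=
        (Continuous.tendsto (by fun_prop) 0).mono_left nhdsWithin_le_nhds
      exact (this.eventually (lt_mem_nhds (by simpa using hw x))).mono fun _ h => le_of_lt h
    · simp only [Filter.eventually_all]
      intro j S hS
      have : Filter.Tendsto (fun c : ℝ => ∑ x ∈ S, (w x + c * pp j x) + c) (nhdsWithin 0 (Set.Ioi 0))
          (nhds (∑ x ∈ S, (w x + 0 * pp j x) + 0)) :=
        (Continuous.tendsto (by fun_prop) 0).mono_left nhdsWithin_le_nhds
      filter_upwards [this.eventually (gt_mem_nhds (show _ < (1:ℝ) by simpa using hS))] with c hc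
      linarith
  exact key.exists

theorem core_s5 {d m : ℕ} [NeZero m] (hd : 0 < d) :
    ∃ (V : Fin (m+1) → Gd d m → ℝ) (c : ℝ), (∀ i x, 0 ≤ V i x) ∧
      (∀ i, ∃ P : Gd d m → Fin (m+1), ∀ b, ∑ x ∈ univ.filter (fun x => P x = b), V i x = 1) ∧
      (∃ B : Gd d m → Fin (m+1), ∀ i, 1 - c ≤ ∑ x ∈ univ.filter (fun x => B x = i), V i x) ∧
      ∀ A : Gd d m → Fin (m+1), (∀ i, 1 - c ≤ ∑ x ∈ univ.filter (fun x => A x = i), V i x) →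
        (univ.filter (fun i => 1 ≤ ∑ x ∈ univ.filter (fun x => A x = i), V i x)).card ≤
          (m + 1 + d - 1) / d + 1 := by
  obtain ⟨w, hw, hbal, hstr⟩ := base_weight (m := m) hd
  obtain ⟨c, hc, hc1, hc2⟩ := small_c w hw
  let grp : Fin (m+1) → Fin d := fun i => ⟨i.val % d, Nat.mod_lt _ hd⟩
  refine ⟨fun i x => w x + c * pp (grp i) x, c, fun i x => hc1 _ x, ?_, ?_, ?_⟩
  · intro i
    refine ⟨partn (grp i), fun b => ?_⟩
    rw [Finset.sum_add_distrib, ← Finset.mul_sum, hbal, pp_bal]; ring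
  · refine ⟨partn ⟨0, hd⟩, fun i => ?_⟩
    rw [Finset.sum_add_distrib, ← Finset.mul_sum, hbal]
    have := pp_ge (m := m) ⟨0, hd⟩ (grp i) i
    nlinarith
  · intro A hA
    have hge : ∀ i, 1 ≤ ∑ x ∈ univ.filter (fun x => A x = i), w x := by
      intro i
      by_contra! h
      have := hc2 (grp i) _ h
      have := hA i
      linarith
    have htot : ∑ i, ∑ x ∈ univ.filter (fun x => A x = i), w x = ∑ i : Fin (m+1), (1:ℝ) := by
      rw [Finset.sum_fiberwise, ← Finset.sum_fiberwise univ (partn ⟨0, hd⟩) w]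
      exact Finset.sum_congr rfl fun b _ => hbal _ b
    have heq : ∀ i, ∑ x ∈ univ.filter (fun x => A x = i), w x = 1 := by
      intro i
      exact (((Finset.sum_eq_sum_iff_of_le (fun i _ => hge i)).mp htot.symm) i (mem_univ _)).symm
    obtain ⟨a1, a2, a3⟩ := hstr _ (heq (A (.inl ())))
    obtain ⟨j0, hj0⟩ := struct_hub _ a1 a2 a3 (by simp)
    have hsub : univ.filter (fun i => 1 ≤ ∑ x ∈ univ.filter (fun x => A x = i), (w x + c * pp (grp i) x))
        ⊆ insert (A (.inl ())) (univ.filter (fun i => grp i = j0)) := by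
      intro i hi
      rw [Finset.mem_filter] at hi
      rw [Finset.mem_insert, Finset.mem_filter]
      by_cases hiz : i = A (.inl ())
      · exact Or.inl hiz
      · right
        refine ⟨mem_univ _, ?_⟩
        obtain ⟨b1, b2, b3⟩ := hstr _ (heq i)
        have hz : ¬ .inl () ∈ univ.filter (fun x => A x = i) := by
          simpa using fun h => hiz h.symm
        obtain ⟨l, k, hlk⟩ := struct_nonhub _ b1 b2 hz
        have hl : l = j0 := by
          by_contra hl
          have h7 := hj0 l hl k
          simp only [Finset.mem_filter, Finset.mem_univ, true_and] at h7 hlk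
          exact hiz (hlk.symm.trans h7)
        subst hl
        by_contra hne
        have h8 := pp_neg _ hz (grp i) l k (fun h => hne h.symm) hlk
        have h9 := hi.2
        rw [Finset.sum_add_distrib, ← Finset.mul_sum, heq] at h9
        nlinarith
    refine (Finset.card_le_card hsub).trans ((Finset.card_insert_le _ _).trans ?_)
    refine Nat.add_le_add_right ?_ 1
    rw [← Finset.card_range ((m + 1 + d - 1) / d)]
    refine Finset.card_le_card_of_injOn (fun i => i.val / d) ?_ ?_
    · intro i _
      simp only [Finset.coe_range, Set.mem_Iio]
      have h1 : i.val / d + 1 = (i.val + d) / d := (Nat.add_div_right _ hd).symm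
      have h2 : (i.val + d) / d ≤ (m + 1 + d - 1) / d := Nat.div_le_div_right (by omega)
      omega
    · intro i hi i' hi' h
      simp only [Finset.coe_filter, Finset.mem_univ, true_and, Set.mem_ofPred_eq] at hi hi'
      have h1 : i.val % d = i'.val % d := by
        have := hi.trans hi'.symm
        simpa [grp] using this
      ext
      rw [← Nat.div_add_mod i.val d, ← Nat.div_add_mod i'.val d, h1]
      simp only at h
      rw [h]

theorem mms_eq_one {G : Type*} [Fintype G] [DecidableEq G] (w : G → ℝ) (k : ℕ) (hk : 0 < k)
    (P : G → Fin k) (hP : ∀ b, ∑ x ∈ univ.filter (fun x => P x = b), w x = 1) :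
    mms univ w k hk = 1 := by
  have htot : ∑ x, w x = k := by
    rw [← Finset.sum_fiberwise univ P w]
    simp [hP]
  apply le_antisymm
  · refine Finset.sup'_le _ _ fun Q _ => ?_
    by_contra! h
    have h2 : ∑ b : Fin k, (1:ℝ) < ∑ b, ∑ x ∈ univ.filter (fun x => Q x = b), w x :=
      Finset.sum_lt_sum_of_nonempty ⟨⟨0, hk⟩, mem_univ _⟩ (fun b hb => lt_of_lt_of_le h (Finset.inf'_le _ hb))
    rw [Finset.sum_fiberwise, htot] at h2
    simp at h2
  · refine le_trans ?_ (Finset.le_sup' _ (mem_univ P))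
    refine Finset.le_inf' _ _ fun b _ => ?_
    rw [hP]

theorem sum_transport {G H κ : Type*} [Fintype G] [Fintype H] [DecidableEq κ] (e : G ≃ H) (A : H → κ)
    (i : κ) (F : G → ℝ) :
    ∑ g ∈ univ.filter (fun g => A g = i), F (e.symm g) =
      ∑ x ∈ univ.filter (fun x => A (e x) = i), F x := by
  symm
  refine Finset.sum_equiv e ?_ ?_ <;> simp

theorem stmt_5 :
    ∃ C : ℝ, 0 < C ∧ ∀ n : ℕ, ∀ hn : 4 ≤ n, ∀ d : ℕ, ∀ hd : 2 ≤ d, ∀ hdn : d ≤ n / 2,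
      ∃ (m : ℕ) (v : Fin n → Fin m → ℝ),
        (m : ℝ) ≤ C * (d : ℝ) * (n : ℝ) ∧ (∀ i g, 0 ≤ v i g) ∧
        (∀ i, 0 < mms Finset.univ (v i) n (by omega)) ∧
        (∀ A : Fin m → Fin n,
          (∀ B : Fin m → Fin n,
            Finset.univ.inf' ⟨⟨0, by omega⟩, Finset.mem_univ _⟩
              (fun i => bval (v i) B i / mms Finset.univ (v i) n (by omega)) ≤
            Finset.univ.inf' ⟨⟨0, by omega⟩, Finset.mem_univ _⟩
              (fun i => bval (v i) A i / mms Finset.univ (v i) n (by omega))) →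
          (Finset.univ.filter
              (fun i => mms Finset.univ (v i) n (by omega) ≤ bval (v i) A i)).card ≤
            (n + d - 1) / d + 1) := by
  refine ⟨3, by norm_num, ?_⟩
  intro n hn d hd hdn
  obtain ⟨m, rfl⟩ : ∃ m, n = m + 1 := ⟨n - 1, by omega⟩
  have : NeZero m := ⟨by omega⟩
  obtain ⟨V, c, hV, hP, ⟨B, hB⟩, hA⟩ := core_s5 (d := d) (m := m) (by omega)
  let e := Fintype.equivFin (Gd d m)
  have hmms : ∀ i, mms Finset.univ (fun g => V i (e.symm g)) (m + 1) (by omega) = 1 := by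
    intro i
    obtain ⟨P, hP⟩ := hP i
    refine mms_eq_one _ _ _ (fun g => P (e.symm g)) fun b => ?_
    rw [sum_transport e (fun g => P (e.symm g)) b (V i)]
    simpa using hP b
  refine ⟨Fintype.card (Gd d m), fun i g => V i (e.symm g), ?_, fun i g => hV i _, ?_, ?_⟩
  · simp only [Fintype.card_sum, Fintype.card_prod, Fintype.card_fin, Fintype.card_unit]
    have : (2:ℝ) ≤ d := by exact_mod_cast hd
    have h0 : (0:ℝ) ≤ m := Nat.cast_nonneg m
    push_cast
    nlinarith
  · intro i
    rw [hmms]; norm_num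
  · intro A hopt
    simp only [hmms, div_one] at hopt ⊢
    have hb : ∀ (A : Fin (Fintype.card (Gd d m)) → Fin (m+1)) i,
        bval (fun g => V i (e.symm g)) A i = ∑ x ∈ univ.filter (fun x => A (e x) = i), V i x :=
      fun A i => sum_transport e A i (V i)
    have h1 := hopt (fun g => B (e.symm g))
    have h2 : ∀ i, 1 - c ≤ bval (fun g => V i (e.symm g)) A i := by
      intro i
      refine le_trans ?_ (Finset.inf'_le (fun i => bval (fun g => V i (e.symm g)) A i) (mem_univ i))
      refine le_trans ?_ h1
      refine Finset.le_inf' _ _ fun i _ => ?_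
      rw [hb]
      simpa using hB i
    simp only [hb] at h2 ⊢
    exact hA (fun x => A (e x)) h2
end

section
/- Fix α ∈ (0, 1]. Suppose that for every fair-division instance with additive nonnegative valuations and any number n' of agents, and for every subset N'' of the agents with |N''| = ⌊α·n'⌋, there exists an allocation giving each agent i ∈ N'' a bundle of value at least MMS_i^{n'}(M). Then for every fair-division instance with n agents with additive nonnegative valuations and every integer k ≥ ⌈n/α⌉, there exists an allocation (A_1, …, A_n) with v_i(A_i) ≥ MMS_i^k(M) for every agent i ∈ N. -/
open Finset

universe u

theorem stmt_6 {G : Type u} [Fintype G] [DecidableEq G]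
    (α : ℝ) (hα0 : 0 < α) (hα1 : α ≤ 1)
    (H : ∀ (G' : Type u) [Fintype G'] [DecidableEq G'] (n' : ℕ) (hn' : 0 < n')
        (v : Fin n' → G' → ℝ), (∀ i g, 0 ≤ v i g) →
        ∀ N'' : Finset (Fin n'), N''.card = ⌊α * (n' : ℝ)⌋₊ →
        ∃ A : G' → Fin n', ∀ i ∈ N'', mms Finset.univ (v i) n' hn' ≤ bval (v i) A i)
    (n : ℕ) (hn : 0 < n) (v : Fin n → G → ℝ) (hv : ∀ i g, 0 ≤ v i g)
    (k : ℕ) (hk : ⌈(n : ℝ) / α⌉₊ ≤ k) :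
    ∃ A : G → Fin n, ∀ i,
      mms Finset.univ (v i) k
        (lt_of_lt_of_le (Nat.ceil_pos.mpr (div_pos (by exact_mod_cast hn) hα0)) hk)
        ≤ bval (v i) A i := by
  have hk0 : 0 < k :=
    lt_of_lt_of_le (Nat.ceil_pos.mpr (div_pos (by exact_mod_cast hn) hα0)) hk
  have h1 : (n : ℝ) / α ≤ k := Nat.ceil_le.mp hk
  have h2 : (n : ℝ) ≤ α * k := by
    rw [div_le_iff₀ hα0] at h1
    linarith
  have h3 : n ≤ ⌊α * (k : ℝ)⌋₊ := Nat.le_floor h2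
  have h4 : ⌊α * (k : ℝ)⌋₊ ≤ k := by
    apply Nat.floor_le_of_le
    have : (0 : ℝ) ≤ k := Nat.cast_nonneg k
    nlinarith
  have hnk : n ≤ k := h3.trans h4
  obtain ⟨N, hsub, -, hcard⟩ := Finset.exists_subsuperset_card_eq
    (Finset.subset_univ (Finset.univ.map (Fin.castLEEmb hnk)))
    (n := ⌊α * (k : ℝ)⌋₊) (by simpa using h3) (by simpa using h4)
  obtain ⟨A, hA⟩ := H G k hk0 (fun j g => if h : j.1 < n then v ⟨j.1, h⟩ g else 0)
    (by
      intro j g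
      split_ifs with h
      · exact hv _ _
      · exact le_rfl) N hcard
  refine ⟨fun g => if h : (A g).1 < n then ⟨(A g).1, h⟩ else ⟨0, hn⟩, fun i => ?_⟩
  have hi := hA (Fin.castLE hnk i) (hsub (by simp))
  have he : (fun g => if h : (Fin.castLE hnk i).1 < n
      then v ⟨(Fin.castLE hnk i).1, h⟩ g else 0) = v i := by
    funext g
    simp
  rw [he] at hi
  refine hi.trans ?_
  unfold bval
  apply Finset.sum_le_sum_of_subset_of_nonneg
  · intro g hg
    simp only [Finset.mem_filter, Finset.mem_univ, true_and] at hg ⊢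
    simp [hg]
  · intro g _ _
    exact hv i g
end

section
/- Let M be a finite set of goods, n ≥ 1 an integer, and for each agent i ∈ N (|N| = n) let v_i be an additive nonnegative valuation on M with MMS_i^n(M) = 1. Then there exist additive nonnegative valuations v'_i with v'_i(g) ≤ v_i(g) for every good g ∈ M, such that for every agent i: v'_i(M) = n and the n-maximin share of i computed with v'_i equals 1. Consequently, any allocation in which some set of agents receive bundles of v'-value at least β also gives those agents bundles of v-value at least β·MMS_i^n(M). -/
open Finset

theorem mms_mono_aux {G : Type*} [Fintype G] [DecidableEq G] (w u : G → ℝ) (k : ℕ) (hk : 0 < k)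
    (h : ∀ g, w g ≤ u g) : mms Finset.univ w k hk ≤ mms Finset.univ u k hk := by
  unfold mms
  apply Finset.sup'_mono_fun
  intro P _
  apply Finset.inf'_mono_fun
  intro j _
  exact Finset.sum_le_sum fun g _ => h g

theorem exists_aux {G : Type*} [Fintype G] [DecidableEq G] (n : ℕ) (hn : 0 < n)
    (v : G → ℝ) (hv : ∀ g, 0 ≤ v g) (hm : mms Finset.univ v n hn = 1) :
    ∃ v' : G → ℝ, (∀ g, 0 ≤ v' g) ∧ (∀ g, v' g ≤ v g) ∧ (∑ g, v' g = (n : ℝ)) ∧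
      mms Finset.univ v' n hn = 1 := by
  have key : ∃ P : G → Fin n, mms Finset.univ v n hn =
      Finset.univ.inf' ⟨⟨0, hn⟩, Finset.mem_univ _⟩ fun j : Fin n =>
        ∑ g ∈ Finset.univ.filter (fun g => P g = j), v g := by
    have hne : (Finset.univ : Finset (G → Fin n)).Nonempty :=
      ⟨fun _ => ⟨0, hn⟩, Finset.mem_univ _⟩
    have := Finset.exists_mem_eq_sup' hne (fun P : G → Fin n =>
      Finset.univ.inf' ⟨⟨0, hn⟩, Finset.mem_univ _⟩ fun j : Fin n =>
        ∑ g ∈ Finset.univ.filter (fun g => P g = j), v g)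
    exact this.imp fun P h => h.2
  obtain ⟨P, hP1⟩ := key
  rw [hm] at hP1
  have hB : ∀ j, 1 ≤ ∑ g ∈ Finset.univ.filter (fun g => P g = j), v g := by
    intro j
    rw [hP1]
    exact Finset.inf'_le _ (Finset.mem_univ j)
  set B : Fin n → ℝ := fun j => ∑ g ∈ Finset.univ.filter (fun g => P g = j), v g with hBdef
  have hB' : ∀ j, 1 ≤ B j := hB
  have hle : ∀ g, v g / B (P g) ≤ v g := fun g => div_le_self (hv g) (hB' _)
  have hs : ∀ j, ∑ g ∈ Finset.univ.filter (fun g => P g = j), v g / B (P g) = 1 := by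
    intro j
    have h1 : ∑ g ∈ Finset.univ.filter (fun g => P g = j), v g / B (P g)
        = ∑ g ∈ Finset.univ.filter (fun g => P g = j), v g / B j := by
      apply Finset.sum_congr rfl
      intro g hg
      rw [(Finset.mem_filter.mp hg).2]
    rw [h1, ← Finset.sum_div]
    exact div_self ((zero_lt_one.trans_le (hB' j)).ne')
  refine ⟨fun g => v g / B (P g), fun g => div_nonneg (hv g) (by linarith [hB' (P g)]), hle, ?_, ?_⟩
  · rw [← Finset.sum_fiberwise Finset.univ P]
    simp [hs]
  · apply le_antisymm
    · rw [← hm]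
      exact mms_mono_aux _ _ n hn hle
    · unfold mms
      refine le_trans ?_ (Finset.le_sup' _ (Finset.mem_univ P))
      apply Finset.le_inf'
      intro j _
      exact (hs j).ge

theorem stmt_10 {G : Type*} [Fintype G] [DecidableEq G] (n : ℕ) (hn : 1 ≤ n)
    (v : Fin n → G → ℝ) (hv : ∀ i g, 0 ≤ v i g)
    (hmms : ∀ i, mms Finset.univ (v i) n (by omega) = 1) :
    ∃ v' : Fin n → G → ℝ,
      (∀ i g, 0 ≤ v' i g) ∧ (∀ i g, v' i g ≤ v i g) ∧
      (∀ i, ∑ g, v' i g = (n : ℝ)) ∧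
      (∀ i, mms Finset.univ (v' i) n (by omega) = 1) ∧
      (∀ (A : G → Fin n) (S : Finset (Fin n)) (β : ℝ),
        (∀ i ∈ S, β ≤ bval (v' i) A i) →
        ∀ i ∈ S, β * mms Finset.univ (v i) n (by omega) ≤ bval (v i) A i) := by
  choose v' h0 h1 h2 h3 using fun i => exists_aux n (by omega) (v i) (hv i) (hmms i)
  refine ⟨v', h0, h1, h2, h3, ?_⟩
  intro A S β h i hi
  rw [hmms i, mul_one]
  exact (h i hi).trans (Finset.sum_le_sum fun g _ => h1 i g)
end

section
/- Let I be a fair-division instance with n ≥ 2 agents and additive nonnegative valuations, let α, β ∈ (0, 1], and suppose agent i ∈ N and bundle B ⊆ M satisfy v_i(B) ≥ MMS_i^n(M) and, for every agent j ≠ i, MMS_j^{n−1}(M \ B) ≥ MMS_j^n(M). If there is a partition (A_j)_{j∈N\{i}} of M \ B among the agents N \ {i} and a set S ⊆ N \ {i} with |S| ≥ ⌊α(n−1)⌋ such that v_j(A_j) ≥ β·MMS_j^{n−1}(M \ B) for every j ∈ S, then the allocation of M obtained by giving B to agent i and A_j to each j ≠ i satisfies: at least ⌊αn⌋ agents j receive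 a bundle of value at least β·MMS_j^n(M) (namely all agents in S ∪ {i}). -/
open Finset

theorem stmt_11 {G : Type*} [Fintype G] [DecidableEq G] (n : ℕ) (hn : 2 ≤ n)
    (v : Fin n → G → ℝ) (hv : ∀ i g, 0 ≤ v i g)
    (α β : ℝ) (hα0 : 0 < α) (hα1 : α ≤ 1) (hβ0 : 0 < β) (hβ1 : β ≤ 1)
    (i : Fin n) (B : Finset G)
    (hB1 : mms Finset.univ (v i) n (by omega) ≤ ∑ g ∈ B, v i g)
    (hB2 : ∀ j, j ≠ i → mms Finset.univ (v j) n (by omega) ≤ mms Bᶜ (v j) (n - 1) (by omega))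
    (Afun : G → Fin n) (hAfun : ∀ g ∈ Bᶜ, Afun g ≠ i)
    (S : Finset (Fin n)) (hiS : i ∉ S) (hS : ⌊α * ((n : ℝ) - 1)⌋₊ ≤ S.card)
    (hSval : ∀ j ∈ S, β * mms Bᶜ (v j) (n - 1) (by omega) ≤
      ∑ g ∈ Bᶜ.filter (fun g => Afun g = j), v j g) :
    ⌊α * (n : ℝ)⌋₊ ≤ (insert i S).card ∧
    ∀ j ∈ insert i S,
      β * mms Finset.univ (v j) n (by omega) ≤
        ∑ g ∈ Finset.univ.filter (fun g => (if g ∈ B then i else Afun g) = j), v j g := by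
  refine ⟨?_, ?_⟩
  · rw [Finset.card_insert_of_notMem hiS]
    have h1 : α * (n : ℝ) ≤ α * ((n : ℝ) - 1) + 1 := by linarith
    have h0 : 0 ≤ α * ((n : ℝ) - 1) := by
      have : (2 : ℝ) ≤ n := by exact_mod_cast hn
      exact mul_nonneg hα0.le (by linarith)
    have h2 := Nat.floor_le_floor h1
    rw [Nat.floor_add_one h0] at h2
    omega
  · intro j hj
    rcases Finset.mem_insert.1 hj with rfl | hjS
    · have hsub : B ⊆ Finset.univ.filter (fun g => (if g ∈ B then j else Afun g) = j) := by
        intro g hg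
        simp [hg]
      have h3 : 0 ≤ ∑ g ∈ B, v j g := Finset.sum_nonneg fun g _ => hv j g
      have h4 := Finset.sum_le_sum_of_subset_of_nonneg hsub (fun g _ _ => hv j g)
      have h5 := mul_le_mul_of_nonneg_left hB1 hβ0.le
      have h6 := mul_le_mul_of_nonneg_right hβ1 h3
      linarith
    · have hji : j ≠ i := fun h => hiS (h ▸ hjS)
      have hsub : Bᶜ.filter (fun g => Afun g = j) ⊆
          Finset.univ.filter (fun g => (if g ∈ B then i else Afun g) = j) := by
        intro g hg
        rw [Finset.mem_filter, Finset.mem_compl] at hg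
        simp [hg.1, hg.2]
      have h4 := Finset.sum_le_sum_of_subset_of_nonneg hsub (fun g _ _ => hv j g)
      exact (mul_le_mul_of_nonneg_left (hB2 j hji) hβ0.le).trans ((hSval j hjS).trans h4)
end

section
/- Let I be a fair-division instance with n ≥ 2 agents and additive nonnegative valuations, let S be any set of agents with |S| = ⌊n/2⌋, and let (A_j)_{j∈S} be any partition of all the goods M among the agents of S such that v_i(A_i) ≥ (1/2)·MMS_i^{⌊n/2⌋}(M) for every i ∈ S. Then v_i(A_i) ≥ MMS_i^n(M) for every i ∈ S. -/
open Finset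

theorem stmt_12 {G : Type*} [Fintype G] [DecidableEq G] (n : ℕ) (hn : 2 ≤ n)
    (v : Fin n → G → ℝ) (hv : ∀ i g, 0 ≤ v i g)
    (S : Finset (Fin n)) (hS : S.card = n / 2)
    (A : G → Fin n) (hA : ∀ g, A g ∈ S)
    (hval : ∀ i ∈ S, (1 / 2 : ℝ) * mms Finset.univ (v i) (n / 2) (by omega) ≤ bval (v i) A i) :
    ∀ i ∈ S, mms Finset.univ (v i) n (by omega) ≤ bval (v i) A i := by
  intro i hi
  refine le_trans ?_ (hval i hi)
  unfold mms
  apply Finset.sup'_le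
  intro P _
  have hk : 0 < n / 2 := by omega
  set t := Finset.univ.inf' ⟨(⟨0, by omega⟩ : Fin n), Finset.mem_univ _⟩ fun j : Fin n =>
      ∑ g ∈ Finset.univ.filter (fun g => P g = j), v i g with ht
  have hb : ∀ j : Fin n, t ≤ ∑ g ∈ Finset.univ.filter (fun g => P g = j), v i g :=
    fun j => Finset.inf'_le _ (Finset.mem_univ j)
  -- merge the bundles of `P` modulo `n / 2`
  let Q : G → Fin (n / 2) := fun g => ⟨(P g).val % (n / 2), Nat.mod_lt _ hk⟩
  have key : 2 * t ≤ Finset.univ.inf' ⟨(⟨0, hk⟩ : Fin (n / 2)), Finset.mem_univ _⟩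
      fun j : Fin (n / 2) => ∑ g ∈ Finset.univ.filter (fun g => Q g = j), v i g := by
    apply Finset.le_inf'
    intro j _
    have hj := j.isLt
    let a : Fin n := ⟨j.val, by omega⟩
    let b : Fin n := ⟨j.val + n / 2, by omega⟩
    have hd : Disjoint (Finset.univ.filter (fun g => P g = a))
        (Finset.univ.filter (fun g => P g = b)) := by
      rw [Finset.disjoint_filter]
      intro g _ h1 h2
      have h3 : a.val = b.val := by rw [← h1, ← h2]
      simp only [a, b] at h3
      omega
    have h1 := hb a
    have h2 := hb b
    calc 2 * t ≤ ∑ g ∈ Finset.univ.filter (fun g => P g = a), v i g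
          + ∑ g ∈ Finset.univ.filter (fun g => P g = b), v i g := by linarith
      _ = ∑ g ∈ Finset.univ.filter (fun g => P g = a) ∪
            Finset.univ.filter (fun g => P g = b), v i g := (Finset.sum_union hd).symm
      _ ≤ _ := by
        apply Finset.sum_le_sum_of_subset_of_nonneg
        · intro g hg
          simp only [Finset.mem_union, Finset.mem_filter, Finset.mem_univ, true_and] at hg ⊢
          apply Fin.ext
          rcases hg with h | h
          · simp [Q, h, a, Nat.mod_eq_of_lt hj]
          · simp [Q, h, b, Nat.mod_eq_of_lt hj]
        · intro g _ _
          exact hv i g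
  have h3 := key.trans (Finset.le_sup' (fun P : G → Fin (n / 2) =>
    Finset.univ.inf' ⟨(⟨0, hk⟩ : Fin (n / 2)), Finset.mem_univ _⟩ fun j : Fin (n / 2) =>
      ∑ g ∈ Finset.univ.filter (fun g => P g = j), v i g) (Finset.mem_univ Q))
  linarith
end

section
/- Let M be a finite set of goods, let v be an additive nonnegative valuation on M, and let n ≥ 2 be an integer. Then MMS^{⌊n/2⌋}(M) ≥ 2·MMS^n(M), where MMS^k(M) denotes the k-maximin share of valuation v. -/
open Finset

theorem stmt_13 {G : Type*} [Fintype G] [DecidableEq G] (n : ℕ) (hn : 2 ≤ n)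
    (w : G → ℝ) (hw : ∀ g, 0 ≤ w g) :
    2 * mms Finset.univ w n (by omega) ≤ mms Finset.univ w (n / 2) (by omega) := by
  have hk : 0 < n / 2 := by omega
  have hn0 : 0 < n := by omega
  unfold mms
  have key := Finset.exists_mem_eq_sup' (s := (Finset.univ : Finset (G → Fin n)))
    ⟨fun _ => ⟨0, hn0⟩, Finset.mem_univ _⟩ (fun P : G → Fin n =>
      Finset.univ.inf' ⟨⟨0, hn0⟩, Finset.mem_univ _⟩ fun j : Fin n =>
        ∑ g ∈ Finset.univ.filter (fun g => P g = j), w g)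
  obtain ⟨P, -, hP⟩ := key
  rw [hP]
  refine le_trans ?_ (Finset.le_sup' _
    (Finset.mem_univ (fun g => (⟨(P g).val % (n / 2), Nat.mod_lt _ hk⟩ : Fin (n / 2)))))
  refine Finset.le_inf' _ _ ?_
  intro j _
  have hj := j.isLt
  have h1 := Finset.inf'_le (fun j : Fin n => ∑ g ∈ Finset.univ.filter (fun g => P g = j), w g)
    (Finset.mem_univ (⟨j.val, by omega⟩ : Fin n))
  have h2 := Finset.inf'_le (fun j : Fin n => ∑ g ∈ Finset.univ.filter (fun g => P g = j), w g)
    (Finset.mem_univ (⟨j.val + n / 2, by omega⟩ : Fin n))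
  rw [two_mul]
  refine (add_le_add h1 h2).trans ?_
  rw [← Finset.sum_union]
  · refine Finset.sum_le_sum_of_subset_of_nonneg ?_ (fun g _ _ => hw g)
    intro g hg
    simp only [Finset.mem_union, Finset.mem_filter, Finset.mem_univ, true_and] at hg ⊢
    apply Fin.ext
    rcases hg with h | h
    · simp [h, Nat.mod_eq_of_lt hj]
    · simp [h, Nat.mod_eq_of_lt hj]
  · rw [Finset.disjoint_left]
    intro g hg hg2
    simp only [Finset.mem_filter, Finset.mem_univ, true_and] at hg hg2
    have h3 := hg.symm.trans hg2
    simp only [Fin.mk.injEq] at h3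
    omega
end

section
/- Let I be a fair-division instance with n ≥ 2 agents and additive nonnegative valuations such that v_i(g) < v_i(M)/n for every agent i and every good g. Let S be any set of agents with |S| = ⌊n/2⌋, and let (A_j)_{j∈S} be any partition of all the goods M among the agents of S that is EF1 (among the agents of S). Then v_i(A_i) ≥ MMS_i^n(M) for every i ∈ S. -/
open Finset

theorem stmt_14 {G : Type*} [Fintype G] [DecidableEq G] (n : ℕ) (hn : 2 ≤ n)
    (v : Fin n → G → ℝ) (hv : ∀ i g, 0 ≤ v i g)
    (hsmall : ∀ i g, v i g < (∑ g', v i g') / (n : ℝ))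
    (S : Finset (Fin n)) (hS : S.card = n / 2)
    (A : G → Fin n) (hA : ∀ g, A g ∈ S)
    (hEF1 : ∀ i ∈ S, ∀ j ∈ S,
      (Finset.univ.filter (fun g => A g = j)).Nonempty →
      ∃ g ∈ Finset.univ.filter (fun g => A g = j),
        ∑ g' ∈ (Finset.univ.filter (fun g' => A g' = j)).erase g, v i g' ≤ bval (v i) A i) :
    ∀ i ∈ S, mms Finset.univ (v i) n (by omega) ≤ bval (v i) A i := by
  intro i hi
  have hn0 : (0 : ℝ) < n := by exact_mod_cast (by omega : 0 < n)
  set T : ℝ := ∑ g', v i g' with hT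
  set x : ℝ := bval (v i) A i with hx
  have hT0 : 0 ≤ T := Finset.sum_nonneg fun g _ => hv i g
  have hx0 : 0 ≤ x := Finset.sum_nonneg fun g _ => hv i g
  have hTn : 0 ≤ T / n := div_nonneg hT0 hn0.le
  -- every bundle is worth at most x + T / n to agent i
  have hb : ∀ j ∈ S, ∑ g ∈ Finset.univ.filter (fun g => A g = j), v i g ≤ x + T / n := by
    intro j hj
    rcases (Finset.univ.filter (fun g => A g = j)).eq_empty_or_nonempty with h | h
    · rw [h, Finset.sum_empty]
      linarith
    · obtain ⟨g, hg, hle⟩ := hEF1 i hi j hj h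
      rw [← Finset.sum_erase_add _ _ hg]
      have := hsmall i g
      linarith
  have hsum : T = ∑ j ∈ S, ∑ g ∈ Finset.univ.filter (fun g => A g = j), v i g :=
    (Finset.sum_fiberwise_of_maps_to (fun g _ => hA g) _).symm
  have hle : T ≤ (S.card : ℝ) * (x + T / n) := by
    rw [hsum]
    refine (Finset.sum_le_sum hb).trans ?_
    rw [Finset.sum_const, nsmul_eq_mul, ← hsum]
  have hc : 2 * (S.card : ℝ) ≤ n := by
    exact_mod_cast (by omega : 2 * S.card ≤ n)
  have hc1 : (1 : ℝ) ≤ S.card := by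
    exact_mod_cast (by omega : 1 ≤ S.card)
  have hTT : T = n * (T / n) := by field_simp
  have hxT : T / n ≤ x := by
    by_contra hlt
    have hlt : x < T / n := not_le.mp hlt
    nlinarith
  refine le_trans ?_ hxT
  unfold mms
  refine Finset.sup'_le _ _ fun P _ => ?_
  rw [le_div_iff₀ hn0]
  have hfib : T = ∑ j : Fin n, ∑ g ∈ Finset.univ.filter (fun g => P g = j), v i g :=
    (Finset.sum_fiberwise _ _ _).symm
  rw [hfib]
  have hne : (Finset.univ : Finset (Fin n)).Nonempty := ⟨i, Finset.mem_univ i⟩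
  have := Finset.card_nsmul_le_sum (Finset.univ : Finset (Fin n))
    (fun j => ∑ g ∈ Finset.univ.filter (fun g => P g = j), v i g)
    (Finset.univ.inf' hne
      (fun j => ∑ g ∈ Finset.univ.filter (fun g => P g = j), v i g))
    (fun j hj => Finset.inf'_le
      (fun j => ∑ g ∈ Finset.univ.filter (fun g => P g = j), v i g) hj)
  rw [Finset.card_univ, Fintype.card_fin, nsmul_eq_mul] at this
  rw [mul_comm]
  exact this
end

section
/- Let n ≥ 2 and d ≥ 2 be integers and let S be the order-d tensor with dimensions n×…×n defined in the context. Then for every j ∈ {1,…,d} and every i ∈ {1,…,n}, the slice S_j(i) has sum 1; that is, Σ over all index tuples x ∈ {1,…,n}^d with x_j = i of S(x) equals 1. -/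
open Finset

/-- The order-`d` tensor `S` with dimensions `n × ⋯ × n` (indices are 0-based,
so the paper's index `i ∈ {1,…,n}` corresponds to the `Fin n` value `i - 1`). -/
noncomputable def tensorS (n d : ℕ) (hn : 1 ≤ n) (x : Fin d → Fin n) : ℝ :=
  (∑ c : Fin (n - 1),
    if x = (fun _ => Fin.castLE (Nat.sub_le n 1) c) then
      ((d : ℝ) ^ (n - 1 - (c : ℕ)) - 1) / (d : ℝ) ^ (n - 1 - (c : ℕ)) else 0)
  + (∑ c : Fin (n - 1), ∑ j : Fin d,
    if x = (fun j' => if j' = j then (⟨n - 1, by omega⟩ : Fin n)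
        else Fin.castLE (Nat.sub_le n 1) c) then
      (1 / ((d : ℝ) - 1)) * (1 / (d : ℝ) ^ (n - 1 - (c : ℕ))) else 0)
  + (if x = (fun _ => (⟨n - 1, by omega⟩ : Fin n)) then
      1 - ∑ c ∈ Finset.range (n - 1), (1 / ((d : ℝ) - 1)) * (1 / (d : ℝ) ^ (n - 1 - c)) else 0)

theorem stmt_15 (n d : ℕ) (hn : 2 ≤ n) (hd : 2 ≤ d) (j : Fin d) (i : Fin n) :
    ∑ x ∈ Finset.univ.filter (fun x : Fin d → Fin n => x j = i),
      tensorS n d (by omega) x = 1 := by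
  have key : ∀ (a : Fin d → Fin n) (v : ℝ),
      ∑ x ∈ Finset.univ.filter (fun x : Fin d → Fin n => x j = i),
        (if x = a then v else 0) = if a j = i then v else 0 := by
    intro a v
    rw [Finset.sum_ite_eq']
    simp
  have hd2 : (2 : ℝ) ≤ d := by exact_mod_cast hd
  have hd1 : (d : ℝ) - 1 ≠ 0 := by linarith
  have hd0 : (d : ℝ) ≠ 0 := by linarith
  unfold tensorS
  rw [Finset.sum_add_distrib, Finset.sum_add_distrib, Finset.sum_comm, key]
  simp_rw [key]
  have h2 : ∑ x ∈ Finset.univ.filter (fun x : Fin d → Fin n => x j = i),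
      (∑ c : Fin (n - 1), ∑ j : Fin d,
        if x = (fun j' => if j' = j then (⟨n - 1, by omega⟩ : Fin n)
          else Fin.castLE (Nat.sub_le n 1) c) then
        (1 / ((d : ℝ) - 1)) * (1 / (d : ℝ) ^ (n - 1 - (c : ℕ))) else 0)
      = ∑ c : Fin (n - 1), ∑ k : Fin d,
        if (if j = k then (⟨n - 1, by omega⟩ : Fin n)
          else Fin.castLE (Nat.sub_le n 1) c) = i then
        (1 / ((d : ℝ) - 1)) * (1 / (d : ℝ) ^ (n - 1 - (c : ℕ))) else 0 := by
    rw [Finset.sum_comm]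
    refine Finset.sum_congr rfl fun c _ => ?_
    rw [Finset.sum_comm]
    exact Finset.sum_congr rfl fun k _ => key _ _
  rw [h2]
  by_cases hi : (i : ℕ) = n - 1
  · have hi' : (⟨n - 1, by omega⟩ : Fin n) = i := Fin.ext hi.symm
    have hc : ∀ c : Fin (n - 1), Fin.castLE (Nat.sub_le n 1) c ≠ i := by
      intro c h
      have h3 := congrArg Fin.val h
      have := c.2
      simp at h3
      omega
    have e : ∀ (c : Fin (n - 1)) (k : Fin d), ((if j = k then (⟨n - 1, by omega⟩ : Fin n)
          else Fin.castLE (Nat.sub_le n 1) c) = i) ↔ j = k := by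
      intro c k
      by_cases h : j = k
      · simp [h, hi']
      · simp [h, hc]
    simp only [e]
    simp only [hc, hi', if_true, if_false, Finset.sum_ite_eq, Finset.mem_univ,
      Finset.sum_const_zero]
    rw [Fin.sum_univ_eq_sum_range
      (fun c => (1 / ((d : ℝ) - 1)) * (1 / (d : ℝ) ^ (n - 1 - c))) (n - 1)]
    ring
  · have hi' : (⟨n - 1, by omega⟩ : Fin n) ≠ i := fun h => hi (congrArg Fin.val h).symm
    have hlt : (i : ℕ) < n - 1 := by have := i.2; omega
    have hc : ∀ c : Fin (n - 1), Fin.castLE (Nat.sub_le n 1) c = i ↔ c = ⟨i, hlt⟩ := by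
      intro c
      simp [Fin.ext_iff]
    have e : ∀ (c : Fin (n - 1)) (k : Fin d), ((if j = k then (⟨n - 1, by omega⟩ : Fin n)
          else Fin.castLE (Nat.sub_le n 1) c) = i) ↔ (c = ⟨i, hlt⟩ ∧ ¬ j = k) := by
      intro c k
      by_cases h : j = k
      · simp [h, hi']
      · simp [h, hc]
    have inner : ∀ v : ℝ, ∑ k : Fin d, (if ¬ j = k then v else 0) = ((d : ℝ) - 1) * v := by
      intro v
      have : ∀ k : Fin d, (if ¬ j = k then v else 0) = v - if j = k then v else 0 := by
        intro k; split_ifs <;> simp_all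
      simp_rw [this]
      rw [Finset.sum_sub_distrib, Finset.sum_ite_eq]
      simp
      ring
    have inner2 : ∀ c : Fin (n - 1), ∑ k : Fin d, (if (c = ⟨i, hlt⟩ ∧ ¬ j = k) then
        (1 / ((d : ℝ) - 1)) * (1 / (d : ℝ) ^ (n - 1 - (c : ℕ))) else 0)
        = if c = ⟨i, hlt⟩ then 1 / (d : ℝ) ^ (n - 1 - (c : ℕ)) else 0 := by
      intro c
      by_cases h : c = ⟨i, hlt⟩
      · simp only [h, true_and, if_true]
        rw [inner]
        field_simp
      · simp [h]
    simp only [e, hc, hi', if_false, inner2, Finset.sum_ite_eq', Finset.mem_univ, if_true]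
    field_simp
    ring
end

section
/- Let n ≥ 4 and d ≥ 2 be integers, let ε > 0 be real, and let T be the order-d tensor with dimensions n×…×n defined in the context. Then for every j ∈ {1,…,d} and every i ∈ {1,…,n}, the slice T_j(i) has sum 0; that is, Σ over all index tuples x ∈ {1,…,n}^d with x_j = i of T(x) equals 0. -/
open Finset

/-- `r_{ij} = ε^{d(n−1) − d·i − j + 1}` (with a possibly negative integer exponent). -/
noncomputable def rr (n d : ℕ) (ε : ℝ) (i j : ℕ) : ℝ :=
  ε ^ ((d : ℤ) * ((n : ℤ) - 1) - (d : ℤ) * (i : ℤ) - (j : ℤ) + 1)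

/-- `u_{1j} = r_{1j}` and
`u_{ij} = (1/(d−1))·Σ_{k≠j} (−u_{i−1,k}) + ((d−2)/(d−1))·u_{i−1,j} + r_{ij}`. -/
noncomputable def uu (n d : ℕ) (ε : ℝ) : ℕ → ℕ → ℝ
  | 0, _ => 0
  | 1, j => rr n d ε 1 j
  | i + 2, j =>
      (1 / ((d : ℝ) - 1)) * (∑ k ∈ (Finset.Icc 1 d).erase j, -(uu n d ε (i + 1) k))
      + (((d : ℝ) - 2) / ((d : ℝ) - 1)) * uu n d ε (i + 1) j
      + rr n d ε (i + 2) j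

/-- `ξ_j = u_{n−1,j} − r_{n−1,j}`. -/
noncomputable def xiT (n d : ℕ) (ε : ℝ) (j : ℕ) : ℝ :=
  uu n d ε (n - 1) j - rr n d ε (n - 1) j

/-- `z₁ = (Σ_{i=1}^{n−2} r_{i1}) − ξ₁`. -/
noncomputable def zT (n d : ℕ) (ε : ℝ) : ℝ :=
  (∑ i ∈ Finset.Icc 1 (n - 2), rr n d ε i 1) - xiT n d ε 1

/-- The order-`d` perturbation tensor `T_ε` with dimensions `n × ⋯ × n` (0-based indices:
the paper's index `i ∈ {1,…,n}` corresponds to the `Fin n` value `i - 1`). -/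
noncomputable def tensorT (n d : ℕ) (ε : ℝ) (hn : 1 ≤ n) (x : Fin d → Fin n) : ℝ :=
  (∑ c : Fin (n - 2), ∑ j : Fin d,
    if x = (fun j' => if j' = j then (⟨n - 1, by omega⟩ : Fin n)
        else Fin.castLE (by omega : n - 2 ≤ n) c) then
      -(rr n d ε ((c : ℕ) + 1) ((j : ℕ) + 1)) else 0)
  + (∑ c : Fin (n - 2), ∑ j : Fin d,
    if x = (fun j' => if j' = j then (⟨(c : ℕ) + 1, by have := c.isLt; omega⟩ : Fin n)
        else Fin.castLE (by omega : n - 2 ≤ n) c) then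
      uu n d ε ((c : ℕ) + 1) ((j : ℕ) + 1) else 0)
  + (∑ j : Fin d,
    if x = (fun j' => if j' = j then (⟨n - 1, by omega⟩ : Fin n)
        else (⟨n - 2, by omega⟩ : Fin n)) then
      xiT n d ε ((j : ℕ) + 1) else 0)
  + (if x = (fun _ => (⟨n - 1, by omega⟩ : Fin n)) then zT n d ε else 0)

theorem aux_swap {d n : ℕ} (j : Fin d) (i : Fin n) (f : Fin d → Fin n) (a : ℝ) :
    ∑ x ∈ Finset.univ.filter (fun x : Fin d → Fin n => x j = i),
      (if x = f then a else 0) = if f j = i then a else 0 := by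
  rw [Finset.sum_ite_eq']
  simp

theorem aux_split {d n : ℕ} (j : Fin d) (i a b : Fin n) (g : Fin d → ℝ) :
    ∑ k : Fin d, (if (if j = k then a else b) = i then g k else 0)
      = (if (a : ℕ) = i then g j else 0) + (if (b : ℕ) = i then (∑ k, g k) - g j else 0) := by
  rw [← Finset.add_sum_erase _ _ (Finset.mem_univ j)]
  congr 1
  · simp [Fin.ext_iff]
  · have h1 : ∀ k ∈ Finset.univ.erase j, (if (if j = k then a else b) = i then g k else 0)
        = if (b : ℕ) = i then g k else 0 := by
      intro k hk
      rw [if_neg (Ne.symm (Finset.ne_of_mem_erase hk))]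
      simp [Fin.ext_iff]
    rw [Finset.sum_congr rfl h1, ← Finset.add_sum_erase _ g (Finset.mem_univ j)]
    split_ifs <;> simp

theorem aux_total (n d : ℕ) (hn : 4 ≤ n) (ε : ℝ) (j : Fin d) (i : Fin n) :
    ∑ x ∈ Finset.univ.filter (fun x : Fin d → Fin n => x j = i),
      tensorT n d ε (by omega) x =
    (∑ c ∈ range (n - 2), ((if n - 1 = (i : ℕ) then -rr n d ε (c + 1) (j + 1) else 0)
      + (if c = (i : ℕ) then (∑ k : Fin d, -rr n d ε (c + 1) (k + 1))
          - -rr n d ε (c + 1) (j + 1) else 0)))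
    + (∑ c ∈ range (n - 2), ((if c + 1 = (i : ℕ) then uu n d ε (c + 1) (j + 1) else 0)
      + (if c = (i : ℕ) then (∑ k : Fin d, uu n d ε (c + 1) (k + 1))
          - uu n d ε (c + 1) (j + 1) else 0)))
    + ((if n - 1 = (i : ℕ) then xiT n d ε (j + 1) else 0)
      + (if n - 2 = (i : ℕ) then (∑ k : Fin d, xiT n d ε (k + 1)) - xiT n d ε (j + 1) else 0))
    + (if n - 1 = (i : ℕ) then zT n d ε else 0) := by
  unfold tensorT
  rw [Finset.sum_add_distrib, Finset.sum_add_distrib, Finset.sum_add_distrib]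
  congr 1
  · congr 1
    · congr 1
      · rw [Finset.sum_comm, Finset.sum_range]
        refine Finset.sum_congr rfl fun c _ => ?_
        rw [Finset.sum_comm]
        simp only [aux_swap]
        rw [aux_split j i _ _ (fun k => -rr n d ε (c + 1) (k + 1))]
        simp
      · rw [Finset.sum_comm, Finset.sum_range]
        refine Finset.sum_congr rfl fun c _ => ?_
        rw [Finset.sum_comm]
        simp only [aux_swap]
        rw [aux_split j i _ _ (fun k => uu n d ε (c + 1) (k + 1))]
        simp
    · rw [Finset.sum_comm]
      simp only [aux_swap]
      rw [aux_split j i _ _ (fun k => xiT n d ε (k + 1))]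
  · rw [aux_swap]
    simp [Fin.ext_iff]

theorem aux_rec (n d : ℕ) (hd : 2 ≤ d) (ε : ℝ) (c : ℕ) (j : Fin d) :
    uu n d ε (c + 2) (j + 1) = uu n d ε (c + 1) (j + 1) + rr n d ε (c + 2) (j + 1)
      - (∑ k : Fin d, uu n d ε (c + 1) (k + 1)) / ((d : ℝ) - 1) := by
  have hd' : (d : ℝ) - 1 ≠ 0 := by
    have : (2 : ℝ) ≤ d := by exact_mod_cast hd
    linarith
  have hs : ∑ k : Fin d, uu n d ε (c + 1) (k + 1) = ∑ k ∈ Finset.Icc 1 d, uu n d ε (c + 1) k := by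
    rw [← Finset.sum_range (fun k => uu n d ε (c + 1) (k + 1)), Finset.range_eq_Ico,
      Finset.sum_Ico_add' (fun k => uu n d ε (c + 1) k)]
    rfl
  have hj : (j : ℕ) + 1 ∈ Finset.Icc 1 d := by
    have := j.isLt
    simp
  rw [hs, ← Finset.add_sum_erase _ _ hj, uu, Finset.sum_neg_distrib]
  field_simp
  ring

theorem aux_row (n d : ℕ) (hd : 2 ≤ d) (ε : ℝ) (c : ℕ) (j : Fin d) :
    uu n d ε (c + 1) (j + 1) + ((∑ k : Fin d, (uu n d ε (c + 2) (k + 1) - rr n d ε (c + 2) (k + 1)))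
      - (uu n d ε (c + 2) (j + 1) - rr n d ε (c + 2) (j + 1))) = 0 := by
  have hd' : (d : ℝ) - 1 ≠ 0 := by
    have : (2 : ℝ) ≤ d := by exact_mod_cast hd
    linarith
  have h : ∀ k : Fin d, uu n d ε (c + 2) (k + 1) - rr n d ε (c + 2) (k + 1) =
      uu n d ε (c + 1) (k + 1) - (∑ k : Fin d, uu n d ε (c + 1) (k + 1)) / ((d : ℝ) - 1) := by
    intro k
    rw [aux_rec n d hd]; ring
  simp only [h, Finset.sum_sub_distrib, Finset.sum_const, Finset.card_univ, Fintype.card_fin,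
    nsmul_eq_mul]
  field_simp
  ring

theorem aux_const (n d : ℕ) (hd : 2 ≤ d) (ε : ℝ) (c : ℕ) (j k : Fin d) :
    (∑ a ∈ range (c + 1), rr n d ε (a + 1) (j + 1)) - uu n d ε (c + 1) (j + 1)
    = (∑ a ∈ range (c + 1), rr n d ε (a + 1) (k + 1)) - uu n d ε (c + 1) (k + 1) := by
  induction c with
  | zero => simp [uu]
  | succ c ih =>
    rw [Finset.sum_range_succ, Finset.sum_range_succ _ (c + 1), aux_rec n d hd, aux_rec n d hd]
    linarith

theorem stmt_16 (n d : ℕ) (hn : 4 ≤ n) (hd : 2 ≤ d) (ε : ℝ) (hε : 0 < ε)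
    (j : Fin d) (i : Fin n) :
    ∑ x ∈ Finset.univ.filter (fun x : Fin d → Fin n => x j = i),
      tensorT n d ε (by omega) x = 0 := by
  rw [aux_total n d hn]
  obtain ⟨m, rfl⟩ : ∃ m, n = m + 4 := ⟨n - 4, by omega⟩
  obtain ⟨i, hi⟩ := i
  have e1 : m + 4 - 1 = m + 3 := by omega
  have e2 : m + 4 - 2 = m + 2 := by omega
  simp only [e1, e2, xiT, zT, Finset.sum_add_distrib, Finset.sum_ite_eq', Finset.mem_range]
  by_cases h3 : i = m + 3
  · subst h3
    have h0 : ∑ c ∈ range (m + 2), (if c + 1 = m + 3 then uu (m + 4) d ε (c + 1) (j + 1) else 0)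
        = 0 := by
      refine Finset.sum_eq_zero fun c hc => ?_
      have := Finset.mem_range.1 hc
      rw [if_neg (by omega)]
    have hz : ∑ a ∈ Finset.Icc 1 (m + 2), rr (m + 4) d ε a 1
        = ∑ a ∈ range (m + 2), rr (m + 4) d ε (a + 1) 1 := by
      rw [Finset.range_eq_Ico, Finset.sum_Ico_add' (fun a => rr (m + 4) d ε a 1)]
      rfl
    have hc := aux_const (m + 4) d hd ε (m + 2) j ⟨0, by omega⟩
    rw [Finset.sum_range_succ, Finset.sum_range_succ _ (m + 2)] at hc
    simp only [zero_add] at hc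
    rw [h0, hz]
    simp
    linarith
  · rcases i with _ | c
    · simp [uu]
    · have h0 : ∑ a ∈ range (m + 2), (if a + 1 = c + 1 then uu (m + 4) d ε (a + 1) (j + 1) else 0)
        = uu (m + 4) d ε (c + 1) (j + 1) := by
        simp only [Nat.add_right_cancel_iff, Finset.sum_ite_eq', Finset.mem_range]
        rw [if_pos (by omega)]
      have hr := aux_row (m + 4) d hd ε c j
      rw [h0]
      have h3' : m + 3 ≠ c + 1 := fun h => h3 h.symm
      by_cases h2 : c + 1 = m + 2
      · obtain rfl : c = m + 1 := by omega
        simp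
        simp at hr
        linarith
      · have h4 : c + 1 < m + 2 := by omega
        have h2' : m + 2 ≠ c + 1 := fun h => h2 h.symm
        simp only [if_neg h3', if_pos h4, if_neg h2', Finset.sum_const_zero]
        rw [Finset.sum_sub_distrib] at hr
        simp only [Finset.sum_neg_distrib]
        linarith
end
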